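/- arXiv:2511.03885 — 2 statements merged into one kernel-verified Lean document; each statement's English description precedes it below -/
import Mathlib

section
/- Let n ≥ 4, let S be an iterated sequence for Gr(3,n), I ∈ I_{2,n}, J ∈ I_{4,n} with R_{I,J} ≠ 0. Then the minimum with respect to ⪯_{Ψ_S} of the set { v_S(p̄_{I∪j}) + v_S(p̄_{J∖j}) : j ∈ J, j ∉ I } equals the maximum of this set with respect to the lexicographic order on ℤ^{3(n−3)}. -/
/-!
Common framework: iterated sequences for Gr(3,n), the matrix `A_S`, pullbacks of
Plücker coordinates, the weighted reverse lexicographic order, lowest-term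
valuations, Plücker relations, weighting matrices and initial ideals.
-/

open MvPolynomial

noncomputable section

/-- Height of a positive root `(i,j) ↦ j - i`. -/
def Ht (β : ℕ × ℕ) : ℕ := β.2 - β.1

/-- `IsIter n S` : `S` is an iterated sequence for `Gr(3,n)`: it starts (as base of the
iteration) from a PBW sequence for `Gr(3,4)`, i.e. an ordering of `((1,4),(2,4),(3,4))`,
and for each `r = 5, …, n` a triple `((i₁,r),(i₂,r),(i₃,r))` with `i₁,i₂,i₃ ∈ [r-1]`
pairwise distinct is prepended. -/
inductive IsIter : ℕ → List (ℕ × ℕ) → Prop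
  | base (L : List (ℕ × ℕ)) : L.Perm [(1,4),(2,4),(3,4)] → IsIter 4 L
  | step (r : ℕ) (L : List (ℕ × ℕ)) (i₁ i₂ i₃ : ℕ) :
      4 ≤ r → IsIter r L →
      1 ≤ i₁ → i₁ ≤ r → 1 ≤ i₂ → i₂ ≤ r → 1 ≤ i₃ → i₃ ≤ r →
      i₁ ≠ i₂ → i₁ ≠ i₃ → i₂ ≠ i₃ →
      IsIter (r+1) ((i₁, r+1) :: (i₂, r+1) :: (i₃, r+1) :: L)

/-- `Sorted k n I` : `I ∈ I_{k,n}`, a strictly increasing `k`-tuple in `{1,…,n}`. -/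
def Sorted (k n : ℕ) (I : Fin k → ℕ) : Prop :=
  StrictMono I ∧ ∀ a, 1 ≤ I a ∧ I a ≤ n

/-- `ℕ`-indexed square "matrices" (1-based indexing, size given by a parameter `n`). -/
abbrev NMat := ℕ → ℕ → MvPolynomial (ℕ × ℕ) ℂ

/-- Product of two `n × n` matrices, 1-based indexing. -/
def matMul (n : ℕ) (A B : NMat) : NMat := fun i j => ∑ k ∈ Finset.Icc 1 n, A i k * B k j

/-- Identity matrix. -/
def idN : NMat := fun i j => if i = j then 1 else 0

/-- The factor `1 + x_β f_β`, where `f_β` is the matrix unit in entry `β = (i,j)`. -/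
def factor (β : ℕ × ℕ) : NMat := fun i j =>
  (if i = j then (1 : MvPolynomial (ℕ × ℕ) ℂ) else 0) +
    (if i = β.1 ∧ j = β.2 then (MvPolynomial.X β : MvPolynomial (ℕ × ℕ) ℂ) else 0)

/-- `A_S := (1 + x_{β_N} f_{β_N}) ⋯ (1 + x_{β_1} f_{β_1})` for `S = (β_1, …, β_N)`. -/
def ASmat (n : ℕ) : List (ℕ × ℕ) → NMat
  | [] => idN
  | β :: L => matMul n (ASmat n L) (factor β)

/-- `φ_S^*(p̄_I)` : the determinant of the `3×3` submatrix of `A_S` on rows `(1,2,3)`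
and columns `I = (i₁,i₂,i₃)`. -/
def phiStar (n : ℕ) (S : List (ℕ × ℕ)) (I : Fin 3 → ℕ) : MvPolynomial (ℕ × ℕ) ℂ :=
  Matrix.det (Matrix.of fun a b : Fin 3 => ASmat n S (a.val + 1) (I b))

/-- `Ψ_S(a) = Σ_l a_l Ht(β_l)`, the height-weighted function (written on exponents). -/
def Psi (d : (ℕ × ℕ) →₀ ℕ) : ℕ := d.sum fun β c => c * Ht β

/-- `a <_lex b` : lexicographic comparison of exponent vectors, the coordinates being
read in the order `β_1, …, β_N` of the sequence `S`. -/
def lexLT (S : List (ℕ × ℕ)) (a b : (ℕ × ℕ) →₀ ℕ) : Prop :=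
  ∃ k < S.length, (∀ m < k, a (S.getD m (0,0)) = b (S.getD m (0,0))) ∧
    a (S.getD k (0,0)) < b (S.getD k (0,0))

/-- `a ≤_lex b` on coordinates indexed by `S`. -/
def lexLE (S : List (ℕ × ℕ)) (a b : (ℕ × ℕ) →₀ ℕ) : Prop :=
  lexLT S a b ∨ ∀ k < S.length, a (S.getD k (0,0)) = b (S.getD k (0,0))

/-- `a ≺_{Ψ_S} b` : the strict `Ψ_S`-weighted reverse lexicographic order:
`Ψ_S(a) < Ψ_S(b)`, or `Ψ_S(a) = Ψ_S(b)` and `a >_lex b`. -/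
def psiLT (S : List (ℕ × ℕ)) (a b : (ℕ × ℕ) →₀ ℕ) : Prop :=
  Psi a < Psi b ∨ (Psi a = Psi b ∧ lexLT S b a)

/-- `a ⪯_{Ψ_S} b`. -/
def psiLE (S : List (ℕ × ℕ)) (a b : (ℕ × ℕ) →₀ ℕ) : Prop :=
  Psi a < Psi b ∨ (Psi a = Psi b ∧ lexLE S b a)

open scoped Classical in
/-- The `⪯_{Ψ_S}`-minimum of the support of a polynomial (defaulting to `0` if no
minimum exists). -/
def minSupp (S : List (ℕ × ℕ)) (f : MvPolynomial (ℕ × ℕ) ℂ) : (ℕ × ℕ) →₀ ℕ :=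
  if h : ∃ m ∈ f.support, ∀ m' ∈ f.support, psiLE S m m' then h.choose else 0

/-- The lowest-term valuation `v_S(p̄_I)` : the `⪯_{Ψ_S}`-minimum of the support of
`φ_S^*(p̄_I)`. -/
def valS (n : ℕ) (S : List (ℕ × ℕ)) (I : Fin 3 → ℕ) : (ℕ × ℕ) →₀ ℕ :=
  minSupp S (phiStar n S I)

/-- The index set `I_{3,n}` of Plücker variables. -/
abbrev MI (n : ℕ) := {v : Fin 3 → ℕ // Sorted 3 n v}

/-- The Plücker polynomial ring `ℂ[p_K : K ∈ I_{3,n}]`. -/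
abbrev PRing (n : ℕ) := MvPolynomial (MI n) ℂ

open scoped Classical in
/-- The Plücker variable `p_K`, defined to be `0` if `K` is not strictly increasing
(in particular `p_{I ∪ j} = 0` if `j ∈ I`). -/
def pvar (n : ℕ) (K : Fin 3 → ℕ) : PRing n :=
  if h : Sorted 3 n K then MvPolynomial.X (⟨K, h⟩ : MI n) else 0

/-- `I ∪ j` : the sorted triple obtained by adjoining `j` to the pair `I`. -/
def insert3 (I : Fin 2 → ℕ) (j : ℕ) : Fin 3 → ℕ :=
  fun a => (List.insertionSort (· ≤ ·) [I 0, I 1, j]).getD a 0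

/-- `J ∖ j` : the sorted triple obtained by removing `j` from the 4-tuple `J`. -/
def erase4 (J : Fin 4 → ℕ) (j : ℕ) : Fin 3 → ℕ :=
  fun a => (([J 0, J 1, J 2, J 3]).erase j).getD a 0

/-- The Plücker relation
`R_{I,J} = Σ_{j ∈ J} (−1)^{#{i∈I : i<j} + #{j'∈J : j<j'}} p_{I∪j} p_{J∖j}`. -/
def Rrel (n : ℕ) (I : Fin 2 → ℕ) (J : Fin 4 → ℕ) : PRing n :=
  ∑ a : Fin 4,
    (-1 : PRing n) ^ ((Finset.univ.filter fun b : Fin 2 => I b < J a).card +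
        (Finset.univ.filter fun b : Fin 4 => J a < J b).card) *
      (pvar n (insert3 I (J a)) * pvar n (erase4 J (J a)))

/-- The Plücker ideal `𝓘_{3,n}`, generated by all Plücker relations. -/
def PluckerIdeal (n : ℕ) : Ideal (PRing n) :=
  Ideal.span {f | ∃ I J, Sorted 2 n I ∧ Sorted 4 n J ∧ f = Rrel n I J}

/-- `M_S · m = Σ_K m_K v_S(p̄_K)` : the weighting matrix applied to an exponent. -/
def MSdot (n : ℕ) (S : List (ℕ × ℕ)) (m : MI n →₀ ℕ) : (ℕ × ℕ) →₀ ℕ :=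
  m.sum fun K c => c • valS n S K.val

open scoped Classical in
/-- The initial form `In_{M_S}(f)` : the sum of the terms of `f` whose `M_S`-weight is
`⪯_{Ψ_S}`-minimal. -/
def inM (n : ℕ) (S : List (ℕ × ℕ)) (f : PRing n) : PRing n :=
  ∑ m ∈ f.support.filter fun m => ∀ m' ∈ f.support, psiLE S (MSdot n S m) (MSdot n S m'),
    MvPolynomial.monomial m (f.coeff m)

/-- The initial ideal `In_{M_S}(𝓘_{3,n}) = ⟨In_{M_S}(g) : g ∈ 𝓘_{3,n}, g ≠ 0⟩`. -/
def InIdeal (n : ℕ) (S : List (ℕ × ℕ)) : Ideal (PRing n) :=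
  Ideal.span {g | ∃ f, f ∈ PluckerIdeal n ∧ f ≠ 0 ∧ g = inM n S f}

/-- Evaluation of the `ℤ`-linear functional with coefficients `c` on an exponent
vector (i.e. an element `e ∈ (ℤ^{3(n-3)})^*` given by its coefficients). -/
def evalF (c : ℕ × ℕ → ℤ) (d : (ℕ × ℕ) →₀ ℕ) : ℤ := d.sum fun β m => c β * (m : ℤ)

/-- `v_S(p̄_{I∪j}) + v_S(p̄_{J∖j})`, the `M_S`-weight of the term of `R_{I,J}`
corresponding to `j = J a`. -/
def wvec (n : ℕ) (S : List (ℕ × ℕ)) (I : Fin 2 → ℕ) (J : Fin 4 → ℕ) (a : Fin 4) :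
    (ℕ × ℕ) →₀ ℕ :=
  valS n S (insert3 I (J a)) + valS n S (erase4 J (J a))

/-- A `ℤ`-linear functional `e` (given by its coefficients `c`) *preserves inequalities*
with respect to `S` if for every nonzero Plücker relation `R_{I,J}` and all
`s₁, s₂ ∈ J ∖ I`, `v_S(p̄_{I∪s₁}) + v_S(p̄_{J∖s₁}) ≺_{Ψ_S} v_S(p̄_{I∪s₂}) + v_S(p̄_{J∖s₂})`
implies the corresponding strict inequality of the values of `e`. -/
def PreservesIneq (n : ℕ) (S : List (ℕ × ℕ)) (c : ℕ × ℕ → ℤ) : Prop :=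
  ∀ (I : Fin 2 → ℕ) (J : Fin 4 → ℕ), Sorted 2 n I → Sorted 4 n J → Rrel n I J ≠ 0 →
    ∀ a b : Fin 4, (∀ t : Fin 2, I t ≠ J a) → (∀ t : Fin 2, I t ≠ J b) →
      psiLT S (wvec n S I J a) (wvec n S I J b) →
      evalF c (wvec n S I J a) < evalF c (wvec n S I J b)

end

/-- Induction for iterated sequences in which the `Gr(3,4)` block is treated as one more
prepended triple, starting from the empty sequence at `n = 3`. -/
theorem IsIter.induction_from_three {P : ℕ → List (ℕ × ℕ) → Prop} (nil : P 3 [])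
    (cons : ∀ (r : ℕ) (L : List (ℕ × ℕ)) (i₁ i₂ i₃ : ℕ), 3 ≤ r → P r L →
      1 ≤ i₁ → i₁ ≤ r → 1 ≤ i₂ → i₂ ≤ r → 1 ≤ i₃ → i₃ ≤ r →
      i₁ ≠ i₂ → i₁ ≠ i₃ → i₂ ≠ i₃ →
      P (r + 1) ((i₁, r + 1) :: (i₂, r + 1) :: (i₃, r + 1) :: L))
    {n : ℕ} {S : List (ℕ × ℕ)} (hS : IsIter n S) : P n S := by
  induction hS with
  | base L hL =>
    obtain ⟨⟨p, p'⟩, ⟨q, q'⟩, ⟨s, s'⟩, rfl⟩ := List.length_eq_three.mp hL.length_eq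
    have hnd := hL.nodup_iff.mpr (by decide)
    have hp := hL.mem_iff.mp (show (p, p') ∈ _ by simp)
    have hq := hL.mem_iff.mp (show (q, q') ∈ _ by simp)
    have hs := hL.mem_iff.mp (show (s, s') ∈ _ by simp)
    simp only [List.mem_cons, Prod.mk.injEq, List.not_mem_nil, or_false] at hp hq hs
    simp only [List.nodup_cons, List.mem_cons, Prod.mk.injEq, List.not_mem_nil, or_false] at hnd
    obtain ⟨rfl, rfl, rfl⟩ : p' = 4 ∧ q' = 4 ∧ s' = 4 := by omega
    exact cons 3 [] p q s le_rfl nil (by omega) (by omega) (by omega) (by omega) (by omega)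
      (by omega) (by omega) (by omega) (by omega)
  | step r L i₁ i₂ i₃ hr _ h₁ h₁' h₂ h₂' h₃ h₃' h₁₂ h₁₃ h₂₃ ih =>
    exact cons r L i₁ i₂ i₃ (by omega) ih h₁ h₁' h₂ h₂' h₃ h₃' h₁₂ h₁₃ h₂₃

theorem IsIter.mem_bounds {n : ℕ} {S : List (ℕ × ℕ)} (hS : IsIter n S) :
    ∀ β ∈ S, β.1 ≤ β.2 := by
  refine hS.induction_from_three (P := fun _ S => ∀ β ∈ S, β.1 ≤ β.2) (by simp) ?_
  intro r L i₁ i₂ i₃ _ ih _ _ _ _ _ _ _ _ _ β hβ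
  simp only [List.mem_cons] at hβ
  rcases hβ with rfl | rfl | rfl | hβ
  · dsimp only; omega
  · dsimp only; omega
  · dsimp only; omega
  · exact ih β hβ

theorem matMul_factor (N : ℕ) (A : NMat) (β : ℕ × ℕ) (i j : ℕ) (hj : j ∈ Finset.Icc 1 N)
    (hβ : β.1 ∈ Finset.Icc 1 N) :
    matMul N A (factor β) i j = A i j + if j = β.2 then A i β.1 * X β else 0 := by
  simp only [matMul, factor, mul_add, Finset.sum_add_distrib, mul_ite, mul_one, mul_zero,
    Finset.sum_ite_eq', hj, if_true]
  by_cases h : j = β.2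
  · simp [h, Finset.sum_ite_eq', hβ]
  · simp [h]

theorem eval_ASmat_congr (N : ℕ) {x y : ℕ × ℕ → ℂ} {S : List (ℕ × ℕ)}
    (h : ∀ β ∈ S, x β = y β) (i j : ℕ) :
    eval x (ASmat N S i j) = eval y (ASmat N S i j) := by
  induction S generalizing i j with
  | nil => simp only [ASmat, idN]; split_ifs <;> simp
  | cons β L ih =>
    simp only [ASmat, matMul, factor, map_sum, map_mul]
    refine Finset.sum_congr rfl fun k _ => ?_
    rw [ih fun γ hγ => h γ (List.mem_cons_of_mem _ hγ)]
    congr 1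
    split_ifs <;> simp [h β]

theorem Fin.injective_three_iff {α : Type*} {f : Fin 3 → α} :
    Function.Injective f ↔ f 0 ≠ f 1 ∧ f 0 ≠ f 2 ∧ f 1 ≠ f 2 := by
  constructor
  · intro h
    exact ⟨h.ne (by decide), h.ne (by decide), h.ne (by decide)⟩
  · rintro ⟨h₁, h₂, h₃⟩ a b hab
    fin_cases a <;> fin_cases b <;> simp_all

/-- For every triple `K` of distinct columns there is a specialization turning the first three
rows of `A_S` into standard basis columns that are pairwise distinct along `K`. -/
theorem IsIter.exists_specialization {n : ℕ} {S : List (ℕ × ℕ)} (hS : IsIter n S) :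
    ∀ N, n ≤ N → ∀ K : Fin 3 → ℕ, Function.Injective K → (∀ b, 1 ≤ K b ∧ K b ≤ n) →
      ∃ (x : ℕ × ℕ → ℂ) (σ : ℕ → Fin 3), Function.Injective (σ ∘ K) ∧
        ∀ (a : Fin 3) (j : ℕ), j ∈ Finset.Icc 1 N →
          eval x (ASmat N S (a.val + 1) j) = if j ≤ n ∧ σ j = a then 1 else 0 := by
  suffices h : (∀ β ∈ S, β.2 ≤ n) ∧ ∀ N, n ≤ N → ∀ K : Fin 3 → ℕ, Function.Injective K →
      (∀ b, 1 ≤ K b ∧ K b ≤ n) →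
      ∃ (x : ℕ × ℕ → ℂ) (σ : ℕ → Fin 3), Function.Injective (σ ∘ K) ∧
        ∀ (a : Fin 3) (j : ℕ), j ∈ Finset.Icc 1 N →
          eval x (ASmat N S (a.val + 1) j) = if j ≤ n ∧ σ j = a then 1 else 0 from h.2
  refine hS.induction_from_three (P := fun n S => (∀ β ∈ S, β.2 ≤ n) ∧
    ∀ N, n ≤ N → ∀ K : Fin 3 → ℕ, Function.Injective K → (∀ b, 1 ≤ K b ∧ K b ≤ n) →
      ∃ (x : ℕ × ℕ → ℂ) (σ : ℕ → Fin 3), Function.Injective (σ ∘ K) ∧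
        ∀ (a : Fin 3) (j : ℕ), j ∈ Finset.Icc 1 N →
          eval x (ASmat N S (a.val + 1) j) = if j ≤ n ∧ σ j = a then 1 else 0) ?_ ?_
  · refine ⟨by simp, fun N _ K hK hb => ⟨0, fun j => Fin.ofNat 3 (j - 1), ?_, ?_⟩⟩
    · intro a b hab
      have ha := hb a
      have hb' := hb b
      simp only [Function.comp, Fin.ofNat, Fin.mk.injEq] at hab
      exact hK (by omega)
    · intro a j hj
      rw [Finset.mem_Icc] at hj
      have : (a.val + 1 = j) ↔ (j ≤ 3 ∧ Fin.ofNat 3 (j - 1) = a) := by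
        simp only [Fin.ext_iff, Fin.ofNat]
        omega
      simp only [ASmat, idN, ← this]
      split_ifs <;> simp
  · rintro r L i₁ i₂ i₃ hr ⟨hL, ih⟩ h₁ h₁' h₂ h₂' h₃ h₃' h₁₂ h₁₃ h₂₃
    refine ⟨?_, fun N hN K hK hb => ?_⟩
    · intro β hβ
      simp only [List.mem_cons] at hβ
      rcases hβ with rfl | rfl | rfl | hβ
      · rfl
      · rfl
      · rfl
      · exact (hL β hβ).trans (Nat.le_succ r)
    obtain ⟨i, hi, hinj⟩ : ∃ i, (i = i₁ ∨ i = i₂ ∨ i = i₃) ∧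
        Function.Injective (Function.update id (r + 1) i ∘ K) := by
      have hK' := Fin.injective_three_iff.mp hK
      simp only [Fin.injective_three_iff, Function.comp, Function.update_apply, id]
      by_contra! hcon
      have c₁ := hcon i₁ (by simp)
      have c₂ := hcon i₂ (by simp)
      have c₃ := hcon i₃ (by simp)
      grind
    obtain ⟨x, σ, hσ, hx⟩ := ih N (by omega) (Function.update id (r + 1) i ∘ K) hinj (by
      intro b
      have := hb b
      simp only [Function.comp, Function.update_apply, id]
      split_ifs <;> omega)
    set y : ℕ × ℕ → ℂ := fun β => if β.2 = r + 1 then (if β.1 = i then 1 else 0) else x β with hy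
    refine ⟨y, σ ∘ Function.update id (r + 1) i, hσ, fun a j hj => ?_⟩
    have hyx : ∀ k ∈ Finset.Icc 1 N,
        eval y (ASmat N L (a.val + 1) k) = if k ≤ r ∧ σ k = a then 1 else 0 := by
      intro k hk
      rw [← hx a k hk]
      refine eval_ASmat_congr N (fun β hβ => ?_) _ _
      have := hL β hβ
      simp only [hy]
      rw [if_neg (by omega)]
    have m₁ : i₁ ∈ Finset.Icc 1 N := Finset.mem_Icc.mpr ⟨h₁, by omega⟩
    have m₂ : i₂ ∈ Finset.Icc 1 N := Finset.mem_Icc.mpr ⟨h₂, by omega⟩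
    have m₃ : i₃ ∈ Finset.Icc 1 N := Finset.mem_Icc.mpr ⟨h₃, by omega⟩
    simp only [ASmat]
    rw [matMul_factor _ _ _ _ _ hj m₁, matMul_factor _ _ _ _ _ hj m₂,
      matMul_factor _ _ _ _ _ hj m₃, matMul_factor _ _ _ _ _ m₁ m₂,
      matMul_factor _ _ _ _ _ m₁ m₃, matMul_factor _ _ _ _ _ m₂ m₃]
    simp only [show i₁ ≠ r + 1 by omega, show i₂ ≠ r + 1 by omega, if_false, add_zero]
    by_cases hjr : j = r + 1
    · subst hjr
      simp only [if_true, map_add, map_mul, eval_X, hyx _ hj, hyx _ m₁, hyx _ m₂, hyx _ m₃]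
      rcases hi with rfl | rfl | rfl <;> simp [*, Ne.symm]
    · simp only [hjr, if_false, add_zero, hyx _ hj, Function.comp, Function.update_apply, id]
      congr 1
      simp only [eq_iff_iff, and_congr_left_iff]
      omega

theorem phiStar_ne_zero {n : ℕ} {S : List (ℕ × ℕ)} (hS : IsIter n S) {K : Fin 3 → ℕ}
    (hK : Function.Injective K) (hb : ∀ b, 1 ≤ K b ∧ K b ≤ n) : phiStar n S K ≠ 0 := by
  obtain ⟨x, σ, hσ, hx⟩ := hS.exists_specialization n le_rfl K hK hb
  intro h0
  have h := congrArg (eval x) h0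
  let τ : Equiv.Perm (Fin 3) := Equiv.ofBijective _ (Finite.injective_iff_bijective.mp hσ)
  have hmat : (eval x).mapMatrix (Matrix.of fun a b : Fin 3 => ASmat n S (a.val + 1) (K b)) =
      (τ.permMatrix ℂ).transpose := by
    ext a b
    have hτ : τ b = σ (K b) := rfl
    simp [hx a (K b) (Finset.mem_Icc.mpr (hb b)), (hb b).2, Matrix.transpose_apply,
      Equiv.Perm.permMatrix, PEquiv.toMatrix_apply, hτ, eq_comm]
  rw [phiStar, RingHom.map_det, hmat, Matrix.det_transpose, Matrix.det_permutation, map_zero] at h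
  rcases Int.units_eq_one_or (Equiv.Perm.sign τ) with hs | hs <;> simp [hs] at h

theorem ASmat_isWeightedHomogeneous (N : ℕ) {S : List (ℕ × ℕ)} (hS : ∀ β ∈ S, β.1 ≤ β.2)
    (i j : ℕ) :
    IsWeightedHomogeneous (fun β => (Ht β : ℤ)) (ASmat N S i j) ((j : ℤ) - i) := by
  induction S generalizing i j with
  | nil =>
    simp only [ASmat, idN]
    split_ifs with h
    · subst h
      simpa using isWeightedHomogeneous_one ℂ (fun β => (Ht β : ℤ))
    · exact isWeightedHomogeneous_zero _ _ _
  | cons β L ih =>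
    simp only [ASmat, matMul]
    refine IsWeightedHomogeneous.sum _ _ _ fun k _ => ?_
    have hA := ih (fun γ hγ => hS γ (List.mem_cons_of_mem _ hγ)) i k
    have hF : IsWeightedHomogeneous (fun β => (Ht β : ℤ)) (factor β k j) ((j : ℤ) - k) := by
      refine IsWeightedHomogeneous.add ?_ ?_
      · split_ifs with h
        · subst h
          simpa using isWeightedHomogeneous_one ℂ (fun β => (Ht β : ℤ))
        · exact isWeightedHomogeneous_zero _ _ _
      · split_ifs with h
        · obtain ⟨rfl, rfl⟩ := h
          have := isWeightedHomogeneous_X ℂ (fun β => (Ht β : ℤ)) β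
          simpa [Ht, Nat.cast_sub (hS β (by simp))] using this
        · exact isWeightedHomogeneous_zero _ _ _
    convert hA.mul hF using 1
    ring

theorem phiStar_isWeightedHomogeneous (n : ℕ) {S : List (ℕ × ℕ)} (hS : ∀ β ∈ S, β.1 ≤ β.2)
    (K : Fin 3 → ℕ) :
    IsWeightedHomogeneous (fun β => (Ht β : ℤ)) (phiStar n S K) ((∑ b, K b : ℕ) - 6 : ℤ) := by
  rw [phiStar, Matrix.det_apply]
  refine IsWeightedHomogeneous.sum _ _ _ fun σ _ => ?_
  have hprod := IsWeightedHomogeneous.prod Finset.univ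
    (fun b : Fin 3 => ASmat n S ((σ b).val + 1) (K b)) (fun b => (K b : ℤ) - ((σ b).val + 1 : ℕ))
    (w := fun β => (Ht β : ℤ)) fun b _ => ASmat_isWeightedHomogeneous n hS _ _
  have hdeg : ∑ b : Fin 3, ((K b : ℤ) - ((σ b).val + 1 : ℕ)) = (∑ b, K b : ℕ) - 6 := by
    rw [Finset.sum_sub_distrib, Equiv.sum_comp σ fun a : Fin 3 => ((a.val + 1 : ℕ) : ℤ)]
    simp [Fin.sum_univ_three]
  rw [hdeg] at hprod
  rcases Int.units_eq_one_or (Equiv.Perm.sign σ) with hs | hs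
  · simpa [hs] using hprod
  · rw [hs, Units.neg_smul, one_smul]
    exact (weightedHomogeneousSubmodule ℂ _ _).neg_mem hprod

theorem Psi_eq_weight (d : (ℕ × ℕ) →₀ ℕ) :
    (Psi d : ℤ) = Finsupp.weight (fun β => (Ht β : ℤ)) d := by
  simp [Psi, Finsupp.weight_apply, Finsupp.sum]

/-- Exponents read along `S`, in the lexicographic linear order. -/
def lexKey (S : List (ℕ × ℕ)) (a : (ℕ × ℕ) →₀ ℕ) : Lex (Fin S.length → ℕ) :=
  toLex fun k => a (S.getD k (0, 0))

theorem lexLE_iff {S : List (ℕ × ℕ)} {a b : (ℕ × ℕ) →₀ ℕ} :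
    lexLE S a b ↔ lexKey S a ≤ lexKey S b := by
  rw [le_iff_lt_or_eq, lexLE]
  refine or_congr ⟨?_, ?_⟩ ⟨?_, ?_⟩
  · rintro ⟨k, hk, heq, hlt⟩
    exact ⟨⟨k, hk⟩, fun m hm => heq m hm, hlt⟩
  · rintro ⟨k, heq, hlt⟩
    exact ⟨k, k.2, fun m hm => heq ⟨m, hm.trans k.2⟩ hm, hlt⟩
  · intro h
    exact congrArg toLex (funext fun k => h k k.2)
  · intro h k hk
    exact congrFun (congrArg ofLex h) ⟨k, hk⟩

theorem valS_mem_support {n : ℕ} {S : List (ℕ × ℕ)} (hS : IsIter n S) {K : Fin 3 → ℕ}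
    (hK : Function.Injective K) (hb : ∀ b, 1 ≤ K b ∧ K b ≤ n) :
    valS n S K ∈ (phiStar n S K).support := by
  have hne := support_nonempty.mpr (phiStar_ne_zero hS hK hb)
  obtain ⟨m, hm, hmax⟩ := Finset.exists_max_image _ (lexKey S) hne
  have hhom := phiStar_isWeightedHomogeneous n hS.mem_bounds K
  have hex : ∃ m ∈ (phiStar n S K).support, ∀ m' ∈ (phiStar n S K).support, psiLE S m m' := by
    refine ⟨m, hm, fun m' hm' => Or.inr ⟨?_, lexLE_iff.mpr (hmax m' hm')⟩⟩
    have e := hhom (mem_support_iff.mp hm)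
    rw [← hhom (mem_support_iff.mp hm'), ← Psi_eq_weight, ← Psi_eq_weight] at e
    exact_mod_cast e
  rw [valS, minSupp, dif_pos hex]
  exact hex.choose_spec.1

theorem Psi_valS {n : ℕ} {S : List (ℕ × ℕ)} (hS : IsIter n S) {K : Fin 3 → ℕ}
    (hK : Function.Injective K) (hb : ∀ b, 1 ≤ K b ∧ K b ≤ n) :
    (Psi (valS n S K) : ℤ) = (∑ b, K b : ℕ) - 6 := by
  rw [Psi_eq_weight]
  exact phiStar_isWeightedHomogeneous n hS.mem_bounds K
    (mem_support_iff.mp (valS_mem_support hS hK hb))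

theorem Psi_valS_getD {n : ℕ} {S : List (ℕ × ℕ)} (hS : IsIter n S) {L : List ℕ}
    (hlen : L.length = 3) (hnd : L.Nodup) (hb : ∀ k ∈ L, 1 ≤ k ∧ k ≤ n) :
    (Psi (valS n S fun a => L.getD a 0) : ℤ) = (L.sum : ℕ) - 6 := by
  obtain ⟨p, q, s, rfl⟩ := List.length_eq_three.mp hlen
  rw [Psi_valS hS]
  · simp [Fin.sum_univ_three, add_assoc]
  · simp only [List.nodup_cons, List.mem_cons, List.not_mem_nil, or_false, not_or] at hnd
    rw [Fin.injective_three_iff]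
    simp [hnd]
  · intro b
    fin_cases b <;> exact hb _ (by simp)

theorem Psi_wvec {n : ℕ} {S : List (ℕ × ℕ)} (hS : IsIter n S) {I : Fin 2 → ℕ} {J : Fin 4 → ℕ}
    (hI : Sorted 2 n I) (hJ : Sorted 4 n J) {a : Fin 4} (ha : ∀ t, I t ≠ J a) :
    (Psi (wvec n S I J a) : ℤ) = (∑ t, I t : ℕ) + (∑ b, J b : ℕ) - 12 := by
  have hperm := List.perm_insertionSort (· ≤ ·) [I 0, I 1, J a]
  have hins : (Psi (valS n S (insert3 I (J a))) : ℤ) = (I 0 + I 1 + J a : ℕ) - 6 := by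
    unfold insert3
    rw [Psi_valS_getD hS, hperm.sum_eq]
    · simp [add_assoc]
    · exact hperm.length_eq
    · rw [hperm.nodup_iff]
      simp [ha, (hI.1 (show (0 : Fin 2) < 1 by decide)).ne]
    · intro k hk
      have hk := hperm.mem_iff.mp hk
      simp only [List.mem_cons, List.not_mem_nil, or_false] at hk
      rcases hk with rfl | rfl | rfl
      exacts [hI.2 0, hI.2 1, hJ.2 a]
  have hofFn : [J 0, J 1, J 2, J 3] = List.ofFn J := by simp [List.ofFn_succ]
  have hmem : J a ∈ List.ofFn J := (List.mem_ofFn' _ _).mpr ⟨a, rfl⟩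
  have her : (Psi (valS n S (erase4 J (J a))) : ℤ) = (∑ b, J b : ℕ) - J a - 6 := by
    unfold erase4
    rw [hofFn, Psi_valS_getD hS]
    · have h := List.sum_erase hmem
      rw [List.sum_ofFn] at h
      omega
    · rw [List.length_erase_of_mem hmem, List.length_ofFn]
    · exact (List.nodup_ofFn.mpr hJ.1.injective).erase _
    · intro k hk
      obtain ⟨b, rfl⟩ := (List.mem_ofFn' _ _).mp (List.mem_of_mem_erase hk)
      exact hJ.2 b
  rw [wvec, Psi_eq_weight, map_add, ← Psi_eq_weight, ← Psi_eq_weight, hins, her,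
    Fin.sum_univ_two]
  push_cast
  ring

/-- The `⪯_{Ψ_S}`-minimum of `{ v_S(p̄_{I∪j}) + v_S(p̄_{J∖j}) : j ∈ J ∖ I }` equals its
lexicographic maximum: some element of this set is simultaneously the `⪯_{Ψ_S}`-minimum
and the `≤_lex`-maximum. -/
theorem psi_min_eq_lex_max (n : ℕ) (hn : 4 ≤ n) (S : List (ℕ × ℕ)) (hS : IsIter n S)
    (I : Fin 2 → ℕ) (J : Fin 4 → ℕ) (hI : Sorted 2 n I) (hJ : Sorted 4 n J)
    (hR : Rrel n I J ≠ 0) :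
    ∃ a : Fin 4, (∀ t : Fin 2, I t ≠ J a) ∧
      ∀ b : Fin 4, (∀ t : Fin 2, I t ≠ J b) →
        psiLE S (wvec n S I J a) (wvec n S I J b) ∧
        lexLE S (wvec n S I J b) (wvec n S I J a) := by
  classical
  let T : Finset (Fin 4) := Finset.univ.filter fun a => ∀ t : Fin 2, I t ≠ J a
  have hT : T.Nonempty := by
    by_contra hempty
    have hsub : Finset.univ.image J ⊆ Finset.univ.image I := by
      intro k hk
      obtain ⟨a, -, rfl⟩ := Finset.mem_image.mp hk
      by_contra hnot
      refine hempty ⟨a, Finset.mem_filter.mpr ⟨Finset.mem_univ a, fun t ht => hnot ?_⟩⟩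
      exact Finset.mem_image.mpr ⟨t, Finset.mem_univ t, ht⟩
    have hcard := Finset.card_le_card hsub
    rw [Finset.card_image_of_injective _ hJ.1.injective,
      Finset.card_image_of_injective _ hI.1.injective] at hcard
    simp at hcard
  obtain ⟨a, haT, hmax⟩ := Finset.exists_max_image T (fun a => lexKey S (wvec n S I J a)) hT
  have ha := (Finset.mem_filter.mp haT).2
  refine ⟨a, ha, fun b hb => ?_⟩
  have hlex : lexLE S (wvec n S I J b) (wvec n S I J a) :=
    lexLE_iff.mpr (hmax b (Finset.mem_filter.mpr ⟨Finset.mem_univ b, hb⟩))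
  refine ⟨Or.inr ⟨?_, hlex⟩, hlex⟩
  exact_mod_cast (Psi_wvec hS hI hJ ha).trans (Psi_wvec hS hI hJ hb).symm
end

section
/- Let n ≥ 4, let S be an iterated sequence for Gr(3,n), and let I ∈ I_{2,n}, J ∈ I_{4,n} be such that R_{I,J} ≠ 0. Then the initial form In_{M_S}(R_{I,J}) is a binomial, i.e. it has exactly two monomials in its support; equivalently, exactly two indices j ∈ J with j ∉ I achieve the ⪯_{Ψ_S}-minimum of { v_S(p̄_{I∪j}) + v_S(p̄_{J∖j}) : j ∈ J, j ∉ I }. -/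
/-!
Common framework: iterated sequences for Gr(3,n), the matrix `A_S`, pullbacks of
Plücker coordinates, the weighted reverse lexicographic order, lowest-term
valuations, Plücker relations, weighting matrices and initial ideals.
-/

open MvPolynomial

/-- Exponent vectors of the ambient polynomial ring of `phiStar`. -/
abbrev Expo := (ℕ × ℕ) →₀ ℕ

section LexOrder

variable {S L : List (ℕ × ℕ)} {a b : Expo}

theorem lexLT_cons {β : ℕ × ℕ} :
    lexLT (β :: L) a b ↔ a β < b β ∨ (a β = b β ∧ lexLT L a b) := by
  constructor
  · rintro ⟨k, hk, h1, h2⟩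
    cases k with
    | zero => exact Or.inl (by simpa using h2)
    | succ k =>
      refine Or.inr ⟨by simpa using h1 0 (Nat.succ_pos k), k, by simpa using hk, ?_, by simpa using h2⟩
      intro m hm
      simpa using h1 (m + 1) (by omega)
  · rintro (h | ⟨h, k, hk, h1, h2⟩)
    · exact ⟨0, by simp, by simp, by simpa using h⟩
    · refine ⟨k + 1, by simpa using hk, ?_, by simpa using h2⟩
      intro m hm
      cases m with
      | zero => simpa using h
      | succ m => simpa using h1 m (by omega)

theorem lexLT_add_left (c : Expo) : lexLT S (c + a) (c + b) ↔ lexLT S a b := by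
  simp [lexLT]

theorem lexLT_irrefl_of_agree (h : ∀ k < S.length, a (S.getD k (0, 0)) = b (S.getD k (0, 0))) :
    ¬ lexLT S a b := by
  rintro ⟨k, hk, -, h2⟩
  exact h2.ne (h k hk)

theorem lexLT_asymm (h : lexLT S a b) : ¬ lexLT S b a := by
  obtain ⟨k, hk, h1, h2⟩ := h
  rintro ⟨l, hl, h3, h4⟩
  rcases lt_trichotomy k l with h | rfl | h
  · exact h2.ne (h3 k h).symm
  · exact lt_asymm h2 h4
  · exact h4.ne (h1 l h).symm

theorem lexLT.not_lexLE (h : lexLT S a b) : ¬ lexLE S b a := by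
  rintro (h' | h')
  · exact lexLT_asymm h h'
  · exact lexLT_irrefl_of_agree (fun k hk => (h' k hk).symm) h

theorem lexLE_refl : lexLE S a a := Or.inr fun _ _ => rfl

end LexOrder

section Tie

/-- The `lex`-maximum of the finite values `t x`, `x ∈ J`, is attained exactly twice
(or there are no finite values). -/
def Tie (L : List (ℕ × ℕ)) (J : Finset ℕ) (t : ℕ → WithBot Expo) : Prop :=
  (∀ x ∈ J, t x = ⊥) ∨ ∃ x ∈ J, ∃ y ∈ J, x ≠ y ∧ ∃ g : Expo, t x = g ∧ t y = g ∧
    ∀ z ∈ J, z ≠ x → z ≠ y → ∀ h : Expo, t z = h → lexLT L h g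

open scoped Classical in
/-- The first of two extended exponents, unless it is `⊥`. -/
noncomputable def pick (s t : WithBot Expo) : WithBot Expo := if s = ⊥ then t else s

@[simp] theorem pick_bot (t : WithBot Expo) : pick ⊥ t = t := if_pos rfl

theorem pick_of_ne_bot {s : WithBot Expo} (h : s ≠ ⊥) (t : WithBot Expo) : pick s t = s :=
  if_neg h

theorem add_pick (a s t : WithBot Expo) : a + pick s t = pick (a + s) (a + t) := by
  unfold pick
  by_cases hs : s = ⊥
  · simp [hs]
  · by_cases ha : a = ⊥ <;> simp [hs, ha]

theorem pick_add (a s t : WithBot Expo) : pick s t + a = pick (s + a) (t + a) := by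
  simp only [add_comm _ a, add_pick]

variable {L : List (ℕ × ℕ)} {J : Finset ℕ} {t s : ℕ → WithBot Expo}

theorem Tie.congr (h : Tie L J t) (hts : ∀ x ∈ J, s x = t x) : Tie L J s := by
  rcases h with h | ⟨x, hx, y, hy, hxy, g, h1, h2, h3⟩
  · exact Or.inl fun x hx => by rw [hts x hx, h x hx]
  · exact Or.inr ⟨x, hx, y, hy, hxy, g, by rw [hts x hx, h1], by rw [hts y hy, h2],
      fun z hz hzx hzy k hk => h3 z hz hzx hzy k (by rw [← hts z hz, hk])⟩

theorem Tie.comp_equiv (ρ : ℕ ≃ ℕ) (h : Tie L (J.image ρ) t) : Tie L J (t ∘ ρ) := by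
  rcases h with h | ⟨x, hx, y, hy, hxy, g, h1, h2, h3⟩
  · exact Or.inl fun x hx => h _ (Finset.mem_image_of_mem _ hx)
  · obtain ⟨x, hx', rfl⟩ := Finset.mem_image.1 hx
    obtain ⟨y, hy', rfl⟩ := Finset.mem_image.1 hy
    exact Or.inr ⟨x, hx', y, hy', fun h => hxy (by rw [h]), g, h1, h2, fun z hz hzx hzy k hk =>
      h3 _ (Finset.mem_image_of_mem _ hz) (ρ.injective.ne hzx) (ρ.injective.ne hzy) k hk⟩

/-- Two equal values which are the only finite ones tie. -/
theorem Tie.of_pair {x y : ℕ} (hx : x ∈ J) (hy : y ∈ J) (hxy : x ≠ y) (hv : t x = t y)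
    (hz : ∀ z ∈ J, z ≠ x → z ≠ y → t z = ⊥) : Tie L J t := by
  by_cases hb : t x = ⊥
  · refine Or.inl fun z hzJ => ?_
    by_cases h1 : z = x
    · rw [h1, hb]
    by_cases h2 : z = y
    · rw [h2, ← hv, hb]
    exact hz z hzJ h1 h2
  · obtain ⟨g, hg⟩ := WithBot.ne_bot_iff_exists.1 hb
    refine Or.inr ⟨x, hx, y, hy, hxy, g, hg.symm, by rw [← hv, hg], fun z hzJ h1 h2 h hh => ?_⟩
    rw [hz z hzJ h1 h2] at hh
    exact absurd hh WithBot.bot_ne_coe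

/-- The exponent `t x` does not involve the variable `β`. -/
def Free (β : ℕ × ℕ) (w : WithBot Expo) : Prop := ∀ g : Expo, w = g → g β = 0

theorem Free.add {β : ℕ × ℕ} {u w : WithBot Expo} (hu : Free β u) (hw : Free β w) :
    Free β (u + w) := by
  intro g hg
  obtain ⟨a, b, rfl, rfl, rfl⟩ := WithBot.add_eq_coe.1 hg
  simp [hu a rfl, hw b rfl]

theorem Tie.cons {β : ℕ × ℕ} (h : Tie L J t) (hf : ∀ x ∈ J, Free β (t x)) : Tie (β :: L) J t := by
  rcases h with h | ⟨x, hx, y, hy, hxy, g, h1, h2, h3⟩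
  · exact Or.inl h
  · refine Or.inr ⟨x, hx, y, hy, hxy, g, h1, h2, fun z hz hzx hzy k hk => lexLT_cons.2 (Or.inr ⟨?_,
      h3 z hz hzx hzy k hk⟩)⟩
    rw [hf z hz k hk, hf x hx g h1]

theorem Tie.const_add (h : Tie L J t) (e : Expo) : Tie L J (fun x => e + t x) := by
  rcases h with h | ⟨x, hx, y, hy, hxy, g, h1, h2, h3⟩
  · exact Or.inl fun x hx => by simp [h x hx]
  · refine Or.inr ⟨x, hx, y, hy, hxy, e + g, by simp [h1], by simp [h2],
      fun z hz hzx hzy k hk => ?_⟩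
    obtain ⟨a, b, ha, hb, rfl⟩ := WithBot.add_eq_coe.1 hk
    obtain rfl := WithBot.coe_injective ha
    exact (lexLT_add_left _).2 (h3 z hz hzx hzy b hb.symm)

theorem Tie.pick {β : ℕ × ℕ} (hs : Tie L J s) (ht : Tie L J t)
    (hsf : ∀ x ∈ J, Free β (s x)) (htf : ∀ x ∈ J, Free β (t x)) :
    Tie (β :: L) J (fun x => pick ((Finsupp.single β 1 : Expo) + s x) (t x)) := by
  rcases (hs.cons hsf).const_add (Finsupp.single β 1) with h | ⟨x, hx, y, hy, hxy, g, h1, h2, h3⟩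
  · exact (ht.cons htf).congr fun x hx => by simp only [h x hx, pick_bot]
  · refine Or.inr ⟨x, hx, y, hy, hxy, g, ?_, ?_, fun z hz hzx hzy k hk => ?_⟩
    · simp only [h1, ne_eq, WithBot.coe_ne_bot, not_false_eq_true, pick_of_ne_bot]
    · simp only [h2, ne_eq, WithBot.coe_ne_bot, not_false_eq_true, pick_of_ne_bot]
    · by_cases hb : (Finsupp.single β 1 : Expo) + s z = ⊥
      · simp only [hb, pick_bot] at hk
        refine lexLT_cons.2 (Or.inl ?_)
        obtain ⟨a, b, ha, hb, rfl⟩ := WithBot.add_eq_coe.1 h1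
        obtain rfl := WithBot.coe_injective ha
        simp [htf z hz k hk]
      · simp only [pick_of_ne_bot hb] at hk
        exact h3 z hz hzx hzy k hk

end Tie

section TropicalStep

open Equiv (swap)

/-- The tropical term of the relation `R_{I,J}` for the index `x`. -/
noncomputable def term (v : Finset ℕ → WithBot Expo) (I J : Finset ℕ) (x : ℕ) : WithBot Expo :=
  v (insert x I) + v (J.erase x)

/-- Tropical effect of adding `x_β` times column `β.1` to column `β.2`. -/
noncomputable def extend (β : ℕ × ℕ) (v : Finset ℕ → WithBot Expo) (K : Finset ℕ) :
    WithBot Expo :=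
  if β.2 ∈ K ∧ β.1 ∉ K then
    pick ((Finsupp.single β 1 : Expo) + v (K.image (swap β.1 β.2))) (v K)
  else v K

variable {i n : ℕ} {v : Finset ℕ → WithBot Expo} {K : Finset ℕ}

theorem extend_of_notMem (h : n ∉ K) : extend (i, n) v K = v K := if_neg fun hh => h hh.1

theorem extend_of_mem (h : i ∈ K) : extend (i, n) v K = v K := if_neg fun hh => hh.2 h

theorem extend_eq_pick (hn : n ∈ K) (hi : i ∉ K) : extend (i, n) v K =
    pick ((Finsupp.single (i, n) 1 : Expo) + v (K.image (swap i n))) (v K) := if_pos ⟨hn, hi⟩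

theorem extend_eq_add (hn : n ∈ K) (hi : i ∉ K) (hv : v (K.image (swap i n)) ≠ ⊥) :
    extend (i, n) v K = (Finsupp.single (i, n) 1 : Expo) + v (K.image (swap i n)) := by
  rw [extend_eq_pick hn hi, pick_of_ne_bot (by simp [hv])]

theorem image_swap_of_notMem (hn : n ∉ K) (hi : i ∉ K) : K.image (swap i n) = K := by
  refine (Finset.image_congr (g := id) fun x hx => ?_).trans Finset.image_id
  exact Equiv.swap_apply_of_ne_of_ne (fun h => hi (h ▸ hx)) (fun h => hn (h ▸ hx))

theorem image_swap_of_mem (hn : n ∈ K) (hi : i ∈ K) : K.image (swap i n) = K := by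
  refine Finset.eq_of_subset_of_card_le (fun x hx => ?_)
    (Finset.card_image_of_injective _ (Equiv.injective _)).ge
  obtain ⟨y, hy, rfl⟩ := Finset.mem_image.1 hx
  by_cases h1 : y = i
  · simpa [h1] using hn
  by_cases h2 : y = n
  · simpa [h2] using hi
  · simpa [Equiv.swap_apply_of_ne_of_ne h1 h2] using hy

theorem image_insert_erase (ρ : ℕ ≃ ℕ) (I J : Finset ℕ) (x : ℕ) :
    (insert x I).image ρ = insert (ρ x) (I.image ρ) ∧
      (J.erase x).image ρ = (J.image ρ).erase (ρ x) :=
  ⟨Finset.image_insert _ _ _, Finset.image_erase ρ.injective _ _⟩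

/-- The properties of the valuation that are preserved while column `n` is being built. -/
structure TropInv (n : ℕ) (L : List (ℕ × ℕ)) (v : Finset ℕ → WithBot Expo) : Prop where
  card_eq : ∀ K, v K ≠ ⊥ → K.card = 3
  finite : ∀ K, K.card = 3 → K ⊆ Finset.Ico 1 n → v K ≠ ⊥
  free : ∀ β ∉ L, ∀ K, Free β (v K)
  tie : ∀ I J, I ⊆ Finset.Icc 1 n → J ⊆ Finset.Icc 1 n → I.card = 2 → J.card = 4 →
    Tie L J (term v I J)

variable {L : List (ℕ × ℕ)} {I J : Finset ℕ}

theorem TropInv.bot (h : TropInv n L v) (hK : K.card ≠ 3) : v K = ⊥ :=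
  not_not.1 fun hh => hK (h.card_eq K hh)

theorem card_image_swap : (K.image (swap i n)).card = K.card :=
  Finset.card_image_of_injective _ (Equiv.injective _)

theorem TropInv.extend_bot (h : TropInv n L v) (hK : K.card ≠ 3) : extend (i, n) v K = ⊥ := by
  unfold extend
  simp [h.bot hK, h.bot (K := K.image (swap i n)) (by rwa [card_image_swap])]

theorem TropInv.extend_free (h : TropInv n L v) {β : ℕ × ℕ} (hβ : β ∉ (i, n) :: L) :
    Free β (extend (i, n) v K) := by
  have hL : β ∉ L := fun hh => hβ (List.mem_cons_of_mem _ hh)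
  have hne : (i, n) ≠ β := fun hh => hβ (hh ▸ List.mem_cons_self)
  have h1 : Free β ((Finsupp.single (i, n) 1 : Expo) : WithBot Expo) := by
    intro g hg
    obtain rfl := WithBot.coe_injective hg
    simp [hne]
  unfold extend pick
  split_ifs
  · exact h.free _ hL _
  · exact h1.add (h.free _ hL _)
  · exact h.free _ hL _

theorem image_swap_subset (hi : i ∈ Finset.Ico 1 n) (hK : K ⊆ Finset.Icc 1 n) :
    K.image (swap i n) ⊆ Finset.Icc 1 n := by
  rw [Finset.mem_Ico] at hi
  intro x hx
  obtain ⟨y, hy, rfl⟩ := Finset.mem_image.1 hx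
  rw [Equiv.swap_apply_def]
  split_ifs
  · simp; omega
  · simp; omega
  · exact hK hy

theorem subset_Ico_of_notMem (hK : K ⊆ Finset.Icc 1 n) (hn : n ∉ K) : K ⊆ Finset.Ico 1 n := by
  intro x hx
  have := Finset.mem_Icc.1 (hK hx)
  have : x ≠ n := fun h => hn (h ▸ hx)
  simp; omega

theorem TropInv.term_free (h : TropInv n L v) (hβ : (i, n) ∉ L) (x : ℕ) :
    Free (i, n) (term v I J x) := (h.free _ hβ _).add (h.free _ hβ _)

theorem TropInv.tie_same (h : TropInv n L v) (hβ : (i, n) ∉ L)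
    (hI : I ⊆ Finset.Icc 1 n) (hJ : J ⊆ Finset.Icc 1 n) (hIc : I.card = 2) (hJc : J.card = 4)
    (he : ∀ x ∈ J, term (extend (i, n) v) I J x = term v I J x) :
    Tie ((i, n) :: L) J (term (extend (i, n) v) I J) :=
  ((h.tie I J hI hJ hIc hJc).cons fun x _ => h.term_free hβ x).congr he

/-- `n` occurs in `J` only. -/
theorem TropInv.tie_right (h : TropInv n L v) (hi : i ∈ Finset.Ico 1 n) (hβ : (i, n) ∉ L)
    (hI : I ⊆ Finset.Icc 1 n) (hJ : J ⊆ Finset.Icc 1 n) (hIc : I.card = 2) (hJc : J.card = 4)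
    (hnI : n ∉ I) (hnJ : n ∈ J) : Tie ((i, n) :: L) J (term (extend (i, n) v) I J) := by
  have hin : i ≠ n := (Finset.mem_Ico.1 hi).2.ne
  by_cases hiJ : i ∈ J
  · have hn : term (extend (i, n) v) I J n = pick
        ((Finsupp.single (i, n) 1 : Expo) + (v (insert i I) + v (J.erase n))) (term v I J n) := by
      simp only [term]
      rw [extend_of_notMem (K := J.erase n) (by simp)]
      by_cases hiI : i ∈ I
      · rw [extend_of_mem (by simp [hiI]), h.bot (K := insert i I) (by simp [hiI, hIc])]
        simp
      · rw [extend_eq_pick (by simp) (by simp [hin, hiI]), pick_add,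
          (image_insert_erase (swap i n) I J n).1, image_swap_of_notMem hnI hiI,
          Equiv.swap_apply_right, add_assoc]
    have hi' : term (extend (i, n) v) I J i = pick
        ((Finsupp.single (i, n) 1 : Expo) + (v (insert i I) + v (J.erase n))) (term v I J i) := by
      simp only [term]
      rw [extend_of_mem (K := insert i I) (by simp), extend_eq_pick (by simp [hnJ, hin.symm])
        (by simp), add_pick, (image_insert_erase (swap i n) I J i).2, image_swap_of_mem hnJ hiJ,
        Equiv.swap_apply_left, add_left_comm]
    have ho : ∀ x ∈ J, x ≠ i → x ≠ n → term (extend (i, n) v) I J x = term v I J x := by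
      intro x hx hxi hxn
      rw [term, extend_of_notMem (by simp [hnI, Ne.symm hxn]),
        extend_of_mem (by simp [hiJ, Ne.symm hxi]), term]
    by_cases hw : v (insert i I) + v (J.erase n) = ⊥
    · rw [hw, WithBot.add_bot, pick_bot] at hn hi'
      refine h.tie_same hβ hI hJ hIc hJc fun x hx => ?_
      by_cases hxi : x = i
      · rw [hxi, hi']
      by_cases hxn : x = n
      · rw [hxn, hn]
      exact ho x hx hxi hxn
    · obtain ⟨w, hw⟩ := WithBot.ne_bot_iff_exists.1 hw
      rw [← hw, ← WithBot.coe_add, pick_of_ne_bot WithBot.coe_ne_bot] at hn hi'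
      refine Or.inr ⟨i, hiJ, n, hnJ, hin, _, hi', hn, fun z hz hzi hzn k hk => ?_⟩
      rw [ho z hz hzi hzn] at hk
      exact lexLT_cons.2 (Or.inl (by simp [h.term_free hβ z k hk]))
  · have hs := (h.tie I (J.image (swap i n)) hI (image_swap_subset hi hJ) hIc
      (by rwa [card_image_swap])).comp_equiv (swap i n)
    refine (hs.pick (h.tie I J hI hJ hIc hJc) (fun x _ => h.term_free hβ _)
      (fun x _ => h.term_free hβ _)).congr fun x hx => ?_
    have hxi : x ≠ i := fun hh => hiJ (hh ▸ hx)
    by_cases hxn : x = n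
    · subst hxn
      have e1 : (J.image (swap i x)).erase i = J.erase x := by
        have := (image_insert_erase (swap i x) I J x).2
        rw [Equiv.swap_apply_right] at this
        rw [← this, image_swap_of_notMem] <;> simp [hiJ]
      simp only [term, Function.comp, Equiv.swap_apply_right, e1]
      rw [extend_of_notMem (K := J.erase x) (by simp)]
      by_cases hiI : i ∈ I
      · rw [extend_of_mem (by simp [hiI]), h.bot (K := insert i I) (by simp [hiI, hIc])]
        simp
      · rw [extend_eq_pick (by simp) (by simp [hin, hiI]), pick_add,
          (image_insert_erase (swap i x) I J x).1, image_swap_of_notMem hnI hiI,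
          Equiv.swap_apply_right, add_assoc]
    · simp only [term, Function.comp, Equiv.swap_apply_of_ne_of_ne hxi hxn]
      rw [extend_of_notMem (by simp [hnI, Ne.symm hxn]), extend_eq_pick (by simp [hnJ, Ne.symm hxn])
        (by simp [hiJ]), add_pick, (image_insert_erase (swap i n) I J x).2,
        Equiv.swap_apply_of_ne_of_ne hxi hxn, add_left_comm]

/-- `n` occurs in `I` only. -/
theorem TropInv.tie_left (h : TropInv n L v) (hi : i ∈ Finset.Ico 1 n) (hβ : (i, n) ∉ L)
    (hI : I ⊆ Finset.Icc 1 n) (hJ : J ⊆ Finset.Icc 1 n) (hIc : I.card = 2) (hJc : J.card = 4)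
    (hnI : n ∈ I) (hnJ : n ∉ J) : Tie ((i, n) :: L) J (term (extend (i, n) v) I J) := by
  have hin : i ≠ n := (Finset.mem_Ico.1 hi).2.ne
  by_cases hiI : i ∈ I
  · refine h.tie_same hβ hI hJ hIc hJc fun x hx => ?_
    rw [term, extend_of_mem (by simp [hiI]), extend_of_notMem (by simp [hnJ]), term]
  · have hs := h.tie (I.image (swap i n)) J (image_swap_subset hi hI) hJ
      (by rwa [card_image_swap]) hJc
    refine (hs.pick (h.tie I J hI hJ hIc hJc) (fun x _ => h.term_free hβ _)
      (fun x _ => h.term_free hβ _)).congr fun x hx => ?_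
    have hxn : x ≠ n := fun hh => hnJ (hh ▸ hx)
    simp only [term]
    rw [extend_of_notMem (K := J.erase x) (by simp [hnJ])]
    by_cases hxi : x = i
    · subst hxi
      have : x ∈ I.image (swap x n) := Finset.mem_image.2 ⟨n, hnI, by simp⟩
      rw [extend_of_mem (by simp), h.bot (K := insert x (I.image (swap x n)))]
      · simp
      · rw [Finset.insert_eq_of_mem this, card_image_swap, hIc]; simp
    · rw [extend_eq_pick (by simp [hnI]) (by simp [hiI, Ne.symm hxi]), pick_add,
        (image_insert_erase (swap i n) I J x).1, Equiv.swap_apply_of_ne_of_ne hxi hxn, add_assoc]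

/-- A relation with `I ⊆ J` has two equal terms and no others. -/
theorem tie_of_subset (hv : ∀ K : Finset ℕ, K.card ≠ 3 → v K = ⊥) (hIJ : I ⊆ J)
    (hIc : I.card = 2) (hJc : J.card = 4) : Tie L J (term v I J) := by
  have hc : (J \ I).card = 2 := by rw [Finset.card_sdiff_of_subset hIJ, hIc, hJc]
  obtain ⟨d, e, hde, hJI⟩ := Finset.card_eq_two.1 hc
  have hd : d ∈ J \ I := by simp [hJI]
  have he : e ∈ J \ I := by simp [hJI]
  have hmem : ∀ x, x ∈ J ↔ x ∈ I ∨ x = d ∨ x = e := fun x => by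
    have := congrArg (x ∈ ·) hJI
    simp only [Finset.mem_sdiff, Finset.mem_insert, Finset.mem_singleton, eq_iff_iff] at this
    have := @hIJ x
    tauto
  rw [Finset.mem_sdiff] at hd he
  have h1 : insert d I = J.erase e := by
    ext x
    by_cases hx : x = e <;> simp [hmem, hx, hde.symm, he.2]
    tauto
  have h2 : insert e I = J.erase d := by
    ext x
    by_cases hx : x = d <;> simp [hmem, hx, hde, hd.2]
    tauto
  refine Tie.of_pair hd.1 he.1 hde ?_ fun z hz hzd hze => ?_
  · simp only [term, ← h1, ← h2, add_comm]
  · have : z ∈ I := by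
      have := (hmem z).1 hz
      tauto
    rw [term, hv (insert z I) (by simp [this, hIc]), WithBot.bot_add]

theorem TropInv.finite_image (h : TropInv n L v) (hi : i ∈ Finset.Ico 1 n)
    (hK : K ⊆ Finset.Icc 1 n) (hc : K.card = 3) (hiK : i ∉ K) : v (K.image (swap i n)) ≠ ⊥ := by
  refine h.finite _ (by rwa [card_image_swap]) (subset_Ico_of_notMem (image_swap_subset hi hK) ?_)
  intro hn
  obtain ⟨y, hy, hyn⟩ := Finset.mem_image.1 hn
  rw [Equiv.swap_apply_eq_iff, Equiv.swap_apply_right] at hyn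
  exact hiK (hyn ▸ hy)

/-- `n` occurs in both `I` and `J`. -/
theorem TropInv.tie_both (h : TropInv n L v) (hi : i ∈ Finset.Ico 1 n) (hβ : (i, n) ∉ L)
    (hI : I ⊆ Finset.Icc 1 n) (hJ : J ⊆ Finset.Icc 1 n) (hIc : I.card = 2) (hJc : J.card = 4)
    (hnI : n ∈ I) (hnJ : n ∈ J) : Tie ((i, n) :: L) J (term (extend (i, n) v) I J) := by
  have hin : i ≠ n := (Finset.mem_Ico.1 hi).2.ne
  by_cases hIJ : I ⊆ J
  · exact tie_of_subset (fun K hK => h.extend_bot hK) hIJ hIc hJc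
  have hIJn : ∀ x ∈ I, x ∈ J → x = n := by
    intro x hx hxJ
    by_contra hxn
    have : ({x, n} : Finset ℕ) = I := Finset.eq_of_subset_of_card_le
      (by simp [Finset.insert_subset_iff, hx, hnI]) (by rw [hIc, Finset.card_pair hxn])
    exact hIJ (this ▸ by simp [Finset.insert_subset_iff, hxJ, hnJ])
  have hins : ∀ x ∈ J, x ≠ n → (insert x I).card = 3 ∧ insert x I ⊆ Finset.Icc 1 n :=
    fun x hx hxn => ⟨by rw [Finset.card_insert_of_notMem fun hxI => hxn (hIJn x hxI hx), hIc],
      Finset.insert_subset (hJ hx) hI⟩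
  have hers : ∀ x ∈ J, (J.erase x).card = 3 ∧ J.erase x ⊆ Finset.Icc 1 n :=
    fun x hx => ⟨by rw [Finset.card_erase_of_mem hx, hJc], (Finset.erase_subset _ _).trans hJ⟩
  have hnbot : term (extend (i, n) v) I J n = ⊥ := by
    rw [term, h.extend_bot (K := insert n I) (by simp [hnI, hIc]), WithBot.bot_add]
  have hibot : ∀ I' J', i ∈ I' → I'.card = 2 → term v I' J' i = ⊥ := by
    intro I' J' h1 h2
    rw [term, h.bot (K := insert i I') (by simp [h1, h2]), WithBot.bot_add]
  have hI' := image_swap_subset hi hI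
  have hJ' := image_swap_subset hi hJ
  have hI'c : (I.image (swap i n)).card = 2 := by rwa [card_image_swap]
  have hJ'c : (J.image (swap i n)).card = 4 := by rwa [card_image_swap]
  have hiI' : i ∈ I.image (swap i n) := Finset.mem_image.2 ⟨n, hnI, by simp⟩
  by_cases hiJ : i ∈ J
  · have hiI : i ∉ I := fun hh => hin (hIJn i hh hiJ)
    have hs := h.tie _ J hI' hJ hI'c hJc
    rw [← image_swap_of_mem hnJ hiJ] at hs
    replace hs := hs.comp_equiv
    rw [image_swap_of_mem hnJ hiJ] at hs
    refine ((hs.cons fun x _ => h.term_free hβ _).const_add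
      (Finsupp.single (i, n) 1)).congr fun x hx => ?_
    by_cases hxn : x = n
    · subst hxn
      simp [hnbot, hibot _ _ hiI' hI'c]
    by_cases hxi : x = i
    · subst hxi
      have e1 : insert x I = insert n (I.image (swap x n)) := by
        have := (image_insert_erase (swap x n) I J x).1
        rwa [image_swap_of_mem (by simp [hnI]) (by simp), Equiv.swap_apply_left] at this
      have e2 : (J.erase x).image (swap x n) = J.erase n := by
        rw [(image_insert_erase (swap x n) I J x).2, image_swap_of_mem hnJ hiJ,
          Equiv.swap_apply_left]
      have := h.finite_image hi (hers x hx).2 (hers x hx).1 (by simp)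
      simp only [term, Function.comp, Equiv.swap_apply_left]
      rw [extend_of_mem (by simp), extend_eq_add (by simp [hnJ, hin.symm]) (by simp) this, e2, e1,
        add_left_comm]
    · have hix : i ∉ insert x I := by simp [hiI, Ne.symm hxi]
      have := h.finite_image hi (hins x hx hxn).2 (hins x hx hxn).1 hix
      simp only [term, Function.comp, Equiv.swap_apply_of_ne_of_ne hxi hxn]
      rw [extend_of_mem (K := J.erase x) (by simp [hiJ, Ne.symm hxi]),
        extend_eq_add (by simp [hnI]) hix this, (image_insert_erase (swap i n) I J x).1,
        Equiv.swap_apply_of_ne_of_ne hxi hxn, add_assoc]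
  have herase : ∀ x ∈ J, x ≠ n → extend (i, n) v (J.erase x) =
      (Finsupp.single (i, n) 1 : Expo) + v ((J.image (swap i n)).erase x) := by
    intro x hx hxn
    have hxi : x ≠ i := fun hh => hiJ (hh ▸ hx)
    have := h.finite_image hi (hers x hx).2 (hers x hx).1 (by simp [hiJ])
    rw [extend_eq_add (by simp [hnJ, Ne.symm hxn]) (by simp [hiJ]) this,
      (image_insert_erase (swap i n) I J x).2, Equiv.swap_apply_of_ne_of_ne hxi hxn]
  by_cases hiI : i ∈ I
  · refine ((((h.tie I _ hI hJ' hIc hJ'c).comp_equiv).cons fun x _ => h.term_free hβ _).const_add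
      (Finsupp.single (i, n) 1)).congr fun x hx => ?_
    by_cases hxn : x = n
    · subst hxn
      simp [hnbot, hibot _ _ hiI hIc]
    have hxi : x ≠ i := fun hh => hiJ (hh ▸ hx)
    simp only [term, Function.comp, Equiv.swap_apply_of_ne_of_ne hxi hxn]
    rw [extend_of_mem (by simp [hiI]), herase x hx hxn, add_left_comm]
  · refine ((((h.tie _ _ hI' hJ' hI'c hJ'c).comp_equiv).cons fun x _ =>
      h.term_free hβ _).const_add
        (Finsupp.single (i, n) 1 + Finsupp.single (i, n) 1)).congr fun x hx => ?_
    by_cases hxn : x = n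
    · subst hxn
      simp [hnbot, hibot _ _ hiI' hI'c]
    have hxi : x ≠ i := fun hh => hiJ (hh ▸ hx)
    have hix : i ∉ insert x I := by simp [hiI, Ne.symm hxi]
    have := h.finite_image hi (hins x hx hxn).2 (hins x hx hxn).1 hix
    simp only [term, Function.comp, Equiv.swap_apply_of_ne_of_ne hxi hxn]
    rw [herase x hx hxn, extend_eq_add (by simp [hnI]) hix this,
      (image_insert_erase (swap i n) I J x).1, Equiv.swap_apply_of_ne_of_ne hxi hxn,
      WithBot.coe_add, add_add_add_comm]

theorem TropInv.extend (h : TropInv n L v) (hi : i ∈ Finset.Ico 1 n) (hβ : (i, n) ∉ L) :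
    TropInv n ((i, n) :: L) (extend (i, n) v) where
  card_eq K hK := not_not.1 fun hh => hK (h.extend_bot hh)
  finite K hc hK := by
    rw [extend_of_notMem fun hn => by simpa using hK hn]
    exact h.finite K hc hK
  free β hβ' K := h.extend_free hβ'
  tie I J hI hJ hIc hJc := by
    by_cases hnI : n ∈ I <;> by_cases hnJ : n ∈ J
    · exact h.tie_both hi hβ hI hJ hIc hJc hnI hnJ
    · exact h.tie_left hi hβ hI hJ hIc hJc hnI hnJ
    · exact h.tie_right hi hβ hI hJ hIc hJc hnI hnJ
    · refine h.tie_same hβ hI hJ hIc hJc fun x hx => ?_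
      have : n ≠ x := fun hh => hnJ (hh ▸ hx)
      rw [term, extend_of_notMem (by simp [hnI, this]), extend_of_notMem (by simp [hnJ]), term]

end TropicalStep

section TropicalValuation

open Equiv (swap)

/-- The tropical (combinatorial) counterpart of `valS`, with `⊥` for vanishing minors. -/
noncomputable def tropVal : List (ℕ × ℕ) → Finset ℕ → WithBot Expo
  | [], K => if K = {1, 2, 3} then 0 else ⊥
  | β :: L, K => extend β (tropVal L) K

theorem tropVal_bot (L : List (ℕ × ℕ)) {K : Finset ℕ} (hK : K.card ≠ 3) : tropVal L K = ⊥ := by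
  induction L generalizing K with
  | nil => exact if_neg fun h => hK (by rw [h]; rfl)
  | cons β L ih =>
    rw [tropVal, extend, ih hK, ih (K := K.image (swap β.1 β.2)) (by rwa [card_image_swap])]
    simp

theorem subset_of_tropVal {N : ℕ} (hN : 3 ≤ N) {L : List (ℕ × ℕ)}
    (hL : ∀ β ∈ L, 1 ≤ β.1 ∧ β.1 < β.2 ∧ β.2 ≤ N) {K : Finset ℕ} (hK : tropVal L K ≠ ⊥) :
    K ⊆ Finset.Icc 1 N := by
  induction L generalizing K with
  | nil =>
    have : K = {1, 2, 3} := not_not.1 fun h => hK (if_neg h)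
    subst this
    intro x hx
    simp at hx ⊢
    omega
  | cons β L ih =>
    have ih' := @ih fun β hβ => hL β (List.mem_cons_of_mem _ hβ)
    obtain ⟨h1, h2, h3⟩ := hL β List.mem_cons_self
    by_cases h0 : tropVal L K = ⊥
    · have hs : tropVal L (K.image (swap β.1 β.2)) ≠ ⊥ := fun h => hK (by
        rw [tropVal, extend, h, h0]; simp)
      intro x hx
      have := ih' hs (Finset.mem_image_of_mem (swap β.1 β.2) hx)
      rw [Equiv.swap_apply_def] at this
      split_ifs at this with hx1 hx2
      · simp; omega
      · simp; omega
      · exact this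
    · exact ih' h0

variable {n : ℕ} {L : List (ℕ × ℕ)} {v : Finset ℕ → WithBot Expo}

theorem TropInv.succ (h : TropInv n L v)
    (hf : ∀ K : Finset ℕ, K.card = 3 → K ⊆ Finset.Icc 1 n → v K ≠ ⊥)
    (hs : ∀ K, v K ≠ ⊥ → K ⊆ Finset.Icc 1 n) : TropInv (n + 1) L v where
  card_eq := h.card_eq
  finite K hc hK := hf K hc (hK.trans fun x hx => by simp at hx ⊢; omega)
  free := h.free
  tie I J hI hJ hIc hJc := by
    have hb : ∀ K : Finset ℕ, n + 1 ∈ K → v K = ⊥ := fun K hK => not_not.1 fun hh => by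
      simpa using hs K hh hK
    have hsub : ∀ K ⊆ Finset.Icc 1 (n + 1), n + 1 ∉ K → K ⊆ Finset.Icc 1 n := by
      intro K hK hn x hx
      have h1 := Finset.mem_Icc.1 (hK hx)
      have h2 : x ≠ n + 1 := fun hh => hn (hh ▸ hx)
      simp; omega
    by_cases hnI : n + 1 ∈ I
    · exact Or.inl fun x _ => by rw [term, hb _ (by simp [hnI]), WithBot.bot_add]
    by_cases hnJ : n + 1 ∈ J
    · refine Or.inl fun x _ => ?_
      by_cases hx : x = n + 1
      · rw [term, hb _ (by simp [hx]), WithBot.bot_add]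
      · rw [term, hb (J.erase x) (by simp [hnJ, Ne.symm hx]), WithBot.add_bot]
    · exact h.tie I J (hsub I hI hnI) (hsub J hJ hnJ) hIc hJc

theorem tropInv_nil : TropInv 3 [] (tropVal []) where
  card_eq K hK := not_not.1 fun hh => hK (tropVal_bot [] hh)
  finite K hc hK := by
    have := Finset.card_le_card hK
    simp at this
    omega
  free β _ K g hg := by
    simp only [tropVal] at hg
    split_ifs at hg
    · rw [← WithBot.coe_zero] at hg
      rw [← WithBot.coe_injective hg]; rfl
    · exact absurd hg WithBot.bot_ne_coe
  tie I J _ hJ _ hJc := by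
    have := Finset.card_le_card hJ
    simp [hJc] at this

/-- Induction on iterated sequences, starting from the empty sequence for `Gr(3,3)`. -/
theorem IsIter.induction {P : ℕ → List (ℕ × ℕ) → Prop} (nil : P 3 [])
    (step : ∀ (r : ℕ) (L : List (ℕ × ℕ)) (i₁ i₂ i₃ : ℕ), 3 ≤ r → P r L →
      i₁ ∈ Finset.Ico 1 (r + 1) → i₂ ∈ Finset.Ico 1 (r + 1) → i₃ ∈ Finset.Ico 1 (r + 1) →
      i₁ ≠ i₂ → i₁ ≠ i₃ → i₂ ≠ i₃ → P (r + 1) ((i₁, r + 1) :: (i₂, r + 1) :: (i₃, r + 1) :: L))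
    {n : ℕ} {S : List (ℕ × ℕ)} (hS : IsIter n S) : P n S := by
  induction hS with
  | base L hL =>
    obtain ⟨x, y, z, rfl⟩ := List.length_eq_three.1 hL.length_eq
    have hnd := hL.nodup_iff.2 (by decide)
    have hx := hL.subset (a := x) (by simp)
    have hy := hL.subset (a := y) (by simp)
    have hz := hL.subset (a := z) (by simp)
    simp only [List.mem_cons, List.not_mem_nil, or_false] at hx hy hz
    have key : ∀ w : ℕ × ℕ, w = (1, 4) ∨ w = (2, 4) ∨ w = (3, 4) →
        ∃ i ∈ Finset.Ico 1 (3 + 1), w = (i, 3 + 1) := by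
      rintro w (rfl | rfl | rfl) <;> simp
    obtain ⟨i₁, h₁, rfl⟩ := key x hx
    obtain ⟨i₂, h₂, rfl⟩ := key y hy
    obtain ⟨i₃, h₃, rfl⟩ := key z hz
    simp at hnd
    exact step 3 [] i₁ i₂ i₃ le_rfl nil h₁ h₂ h₃ (by tauto) (by tauto) (by tauto)
  | step r L i₁ i₂ i₃ hr _ a1 a2 b1 b2 c1 c2 h12 h13 h23 ih =>
    exact step r L i₁ i₂ i₃ (by omega) ih (by simp; omega) (by simp; omega) (by simp; omega)
      h12 h13 h23

theorem IsIter.nodup_and_bounds {S : List (ℕ × ℕ)} (hS : IsIter n S) :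
    3 ≤ n ∧ S.Nodup ∧ ∀ β ∈ S, 1 ≤ β.1 ∧ β.1 < β.2 ∧ β.2 ≤ n := by
  refine hS.induction (P := fun n S => 3 ≤ n ∧ S.Nodup ∧ ∀ β ∈ S, 1 ≤ β.1 ∧ β.1 < β.2 ∧ β.2 ≤ n)
    (by simp) fun r L i₁ i₂ i₃ hr ⟨_, hnd, hb⟩ h₁ h₂ h₃ h12 h13 h23 => ?_
  have hL : ∀ i, (i, r + 1) ∉ L := fun i hi => by have := (hb _ hi).2.2; simp at this
  simp only [Finset.mem_Ico] at h₁ h₂ h₃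
  refine ⟨by omega, by simp [hL, hnd, h12, h13, h23], fun β hβ => ?_⟩
  simp only [List.mem_cons] at hβ
  rcases hβ with rfl | rfl | rfl | hβ
  · simp; omega
  · simp; omega
  · simp; omega
  · have := hb β hβ
    omega

theorem IsIter.tropInv {S : List (ℕ × ℕ)} (hS : IsIter n S) : TropInv (n + 1) S (tropVal S) := by
  suffices H : 3 ≤ n ∧ (∀ β ∈ S, 1 ≤ β.1 ∧ β.1 < β.2 ∧ β.2 ≤ n) ∧
      TropInv (n + 1) S (tropVal S) from H.2.2
  refine hS.induction (P := fun n S => 3 ≤ n ∧ (∀ β ∈ S, 1 ≤ β.1 ∧ β.1 < β.2 ∧ β.2 ≤ n) ∧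
    TropInv (n + 1) S (tropVal S)) ⟨le_rfl, by simp, tropInv_nil.succ (fun K hc hK => ?_)
    fun K => subset_of_tropVal le_rfl (by simp)⟩ ?_
  · have : K = {1, 2, 3} := Finset.eq_of_subset_of_card_le hK (by simp [hc])
    simp [tropVal, this]
  · rintro r L i₁ i₂ i₃ hr ⟨_, hb, hL⟩ h₁ h₂ h₃ h12 h13 h23
    have hnL : ∀ i, (i, r + 1) ∉ L := fun i hi => by have := (hb _ hi).2.2; simp at this
    have t₁ := hL.extend h₃ (hnL _)
    have t₂ := t₁.extend h₂ (by simp [hnL, h23])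
    have t₃ := t₂.extend h₁ (by simp [hnL, h12, h13])
    have hb' : ∀ β ∈ (i₁, r + 1) :: (i₂, r + 1) :: (i₃, r + 1) :: L,
        1 ≤ β.1 ∧ β.1 < β.2 ∧ β.2 ≤ r + 1 := by
      intro β hβ
      simp only [Finset.mem_Ico] at h₁ h₂ h₃
      simp only [List.mem_cons] at hβ
      rcases hβ with rfl | rfl | rfl | hβ
      · simp; omega
      · simp; omega
      · simp; omega
      · have := hb β hβ
        omega
    refine ⟨by omega, hb', t₃.succ (fun K hc hK => ?_) fun K => subset_of_tropVal (by omega) hb'⟩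
    by_cases hn : r + 1 ∈ K
    · by_cases m₁ : i₁ ∈ K
      · rw [extend_of_mem m₁]
        by_cases m₂ : i₂ ∈ K
        · rw [extend_of_mem m₂]
          have m₃ : i₃ ∉ K := by
            intro m₃
            have hsub : ({r + 1, i₁, i₂, i₃} : Finset ℕ) ⊆ K := by
              simp [Finset.insert_subset_iff, *]
            have := Finset.card_le_card hsub
            simp only [Finset.mem_Ico] at h₁ h₂ h₃
            rw [Finset.card_insert_of_notMem (by simp; omega),
              Finset.card_insert_of_notMem (by simp; omega), Finset.card_pair h23] at this
            omega
          have := hL.finite_image h₃ hK hc m₃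
          rw [extend_eq_add hn m₃ this]
          simp [this]
        · have := t₁.finite_image h₂ hK hc m₂
          rw [extend_eq_add hn m₂ this]
          simp [this]
      · have := t₂.finite_image h₁ hK hc m₁
        rw [extend_eq_add hn m₁ this]
        simp [this]
    · exact t₃.finite K hc (subset_Ico_of_notMem hK hn)

end TropicalValuation

section LeadingTerm

open Equiv (swap)

/-- `w` is the exponent of the lowest term of `f` (`⊥` if `f = 0`), all terms of `f` have weight
`s - 6`, and `f` involves only the variables in `L`. -/
def Lead (L : List (ℕ × ℕ)) (f : MvPolynomial (ℕ × ℕ) ℂ) (w : WithBot Expo) (s : ℕ) : Prop :=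
  (w = ⊥ ∧ f = 0) ∨ ∃ g : Expo, w = g ∧ g ∈ f.support ∧
    ∀ m ∈ f.support, (m = g ∨ lexLT L m g) ∧ Psi m + 6 = s ∧ ∀ β ∉ L, m β = 0

theorem Psi_add (a b : Expo) : Psi (a + b) = Psi a + Psi b :=
  Finsupp.sum_add_index' (by simp) (by intros; ring)

theorem Psi_single (β : ℕ × ℕ) : Psi (Finsupp.single β 1) = Ht β := by simp [Psi]

variable {L : List (ℕ × ℕ)} {β : ℕ × ℕ} {f f' : MvPolynomial (ℕ × ℕ) ℂ} {w w' : WithBot Expo}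
  {s s' : ℕ}

theorem Lead.support (h : Lead L f w s) {m : Expo} (hm : m ∈ f.support) :
    Psi m + 6 = s ∧ ∀ β ∉ L, m β = 0 := by
  rcases h with ⟨-, rfl⟩ | ⟨g, -, -, h⟩
  · simp at hm
  · exact (h m hm).2

theorem Lead.cons (h : Lead L f w s) (hβ : β ∉ L) : Lead (β :: L) f w s := by
  rcases h with h | ⟨g, hw, hg, h⟩
  · exact Or.inl h
  · refine Or.inr ⟨g, hw, hg, fun m hm => ⟨(h m hm).1.imp_right fun hl => lexLT_cons.2 (Or.inr
      ⟨by rw [(h m hm).2.2 β hβ, (h g hg).2.2 β hβ], hl⟩), (h m hm).2.1, fun γ hγ =>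
        (h m hm).2.2 γ fun hh => hγ (List.mem_cons_of_mem _ hh)⟩⟩

theorem Lead.add_X_mul (h : Lead L f w s) (h' : Lead L f' w' s') (hβ : β ∉ L)
    (hs : s' + Ht β = s) :
    Lead (β :: L) (f + X β * f') (pick ((Finsupp.single β 1 : Expo) + w') w) s := by
  rcases h' with ⟨rfl, rfl⟩ | ⟨g, rfl, hg, h'⟩
  · simpa using h.cons hβ
  · refine Or.inr ⟨Finsupp.single β 1 + g, ?_, ?_, fun m hm => ?_⟩
    · rw [← WithBot.coe_add, pick_of_ne_bot WithBot.coe_ne_bot]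
    · rw [mem_support_iff, coeff_add, coeff_X_mul, notMem_support_iff.1, zero_add]
      · exact mem_support_iff.1 hg
      · intro hm
        simpa using (h.support hm).2 β hβ
    · rcases Finset.mem_union.1 (support_add hm) with hm | hm
      · have := h.support hm
        refine ⟨Or.inr (lexLT_cons.2 (Or.inl ?_)), this.1, fun γ hγ =>
          this.2 γ fun hh => hγ (List.mem_cons_of_mem _ hh)⟩
        simp [this.2 β hβ]
      · rw [support_X_mul, Finset.mem_map] at hm
        obtain ⟨m, hm', rfl⟩ := hm
        obtain ⟨h1, h2, h3⟩ := h' m hm'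
        simp only [addLeftEmbedding_apply]
        refine ⟨h1.imp (fun hh => by rw [hh]) fun hh => ?_, ?_, fun γ hγ => ?_⟩
        · refine lexLT_cons.2 (Or.inr ⟨?_, (lexLT_add_left _).2 hh⟩)
          simp [h3 β hβ, (h' g hg).2.2 β hβ]
        · rw [Psi_add, Psi_single]
          omega
        · have hne : β ≠ γ := fun hh => hγ (hh ▸ List.mem_cons_self)
          simp [hne, h3 γ fun hh => hγ (List.mem_cons_of_mem _ hh)]

variable {N : ℕ} {I : Fin 3 → ℕ}

theorem ASmat_cons {i r a j : ℕ} (hi : i ∈ Finset.Icc 1 N) (hj : j ∈ Finset.Icc 1 N) :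
    ASmat N ((i, r) :: L) a j =
      ASmat N L a j + if j = r then X (i, r) * ASmat N L a i else 0 := by
  simp only [ASmat, matMul, factor, mul_add, Finset.sum_add_distrib]
  congr 1
  · simp [hj]
  · by_cases h : j = r <;> simp [h, hi, mul_comm]

theorem phiStar_eq_zero (hI : ¬ Function.Injective I) : phiStar N L I = 0 := by
  simp only [Function.Injective, not_forall] at hI
  obtain ⟨x, y, hxy, hne⟩ := hI
  exact Matrix.det_zero_of_column_eq hne fun a => by simp [hxy]

theorem phiStar_cons_of_notMem {i r : ℕ} (hi : i ∈ Finset.Icc 1 N)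
    (hI : ∀ a, I a ∈ Finset.Icc 1 N) (hr : ∀ a, I a ≠ r) :
    phiStar N ((i, r) :: L) I = phiStar N L I := by
  simp [phiStar, ASmat_cons hi (hI _), hr]

theorem phiStar_cons {i r : ℕ} (hi : i ∈ Finset.Icc 1 N)
    (hI : ∀ a, I a ∈ Finset.Icc 1 N) (hinj : Function.Injective I) (z : Fin 3) (hr : I z = r) :
    phiStar N ((i, r) :: L) I =
      phiStar N L I + X (i, r) * phiStar N L (Function.update I z i) := by
  have e0 : (Matrix.of fun a b : Fin 3 => ASmat N ((i, r) :: L) (a.val + 1) (I b)) =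
      (Matrix.of fun a b : Fin 3 => ASmat N L (a.val + 1) (I b)).updateCol z
        ((fun a : Fin 3 => ASmat N L (a.val + 1) (I z)) +
          (X (i, r) : MvPolynomial (ℕ × ℕ) ℂ) • fun a : Fin 3 => ASmat N L (a.val + 1) i) := by
    ext1 a b
    simp only [Matrix.of_apply, ASmat_cons hi (hI _), Matrix.updateCol_apply]
    by_cases hb : b = z
    · subst hb; simp [hr]
    · have : I b ≠ r := fun hh => hb (hinj (hh.trans hr.symm))
      simp [hb, this]
  have e1 : (Matrix.of fun a b : Fin 3 => ASmat N L (a.val + 1) (Function.update I z i b)) =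
      (Matrix.of fun a b : Fin 3 => ASmat N L (a.val + 1) (I b)).updateCol z
        (fun a : Fin 3 => ASmat N L (a.val + 1) i) := by
    ext1 a b
    by_cases hb : b = z <;> simp [hb]
  rw [phiStar, e0, Matrix.det_updateCol_add, Matrix.det_updateCol_smul, ← e1]
  congr 2
  ext1 a b
  by_cases hb : b = z <;> simp [hb]

theorem lead_nil (I : Fin 3 → ℕ) :
    Lead [] (phiStar N [] I) (tropVal [] (Finset.univ.image I)) (∑ a, I a) := by
  by_cases hK : Finset.univ.image I = {1, 2, 3}
  · have hm : ∀ a, I a = 1 ∨ I a = 2 ∨ I a = 3 := fun a => by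
      have : I a ∈ Finset.univ.image I := by simp
      simpa [hK] using this
    have hinj : Function.Injective I := by
      rw [← Set.injOn_univ, ← Finset.coe_univ]
      exact Finset.injOn_of_card_image_eq (by rw [hK]; rfl)
    have h01 := hinj.ne (show (0 : Fin 3) ≠ 1 by decide)
    have h02 := hinj.ne (show (0 : Fin 3) ≠ 2 by decide)
    have h12 := hinj.ne (show (1 : Fin 3) ≠ 2 by decide)
    have key : (phiStar N [] I = 1 ∨ phiStar N [] I = -1) ∧ ∑ a, I a = 6 := by
      simp only [phiStar, Matrix.det_fin_three, ASmat, idN, Matrix.of_apply, Fin.sum_univ_three]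
      rcases hm 0 with h0 | h0 | h0 <;> rcases hm 1 with h1 | h1 | h1 <;>
        rcases hm 2 with h2 | h2 | h2 <;> simp [h0, h1, h2] at h01 h02 h12 ⊢
    have hsupp : (phiStar N [] I).support = {0} := by
      rcases key.1 with h | h
      · rw [h, support_one]
      · rw [h, support_neg, support_one]
    refine Or.inr ⟨0, by simp [tropVal, hK], by simp [hsupp], fun m hm => ?_⟩
    obtain rfl : m = 0 := by simpa [hsupp] using hm
    simp [key.2, Psi]
  · refine Or.inl ⟨if_neg hK, ?_⟩
    by_cases hinj : Function.Injective I
    · obtain ⟨x, hx, hxI⟩ : ∃ x ∈ ({1, 2, 3} : Finset ℕ), x ∉ Finset.univ.image I := by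
        by_contra! hh
        exact hK (Finset.eq_of_subset_of_card_le hh
          (by rw [Finset.card_image_of_injective _ hinj]; rfl)).symm
      obtain ⟨a, rfl⟩ : ∃ a : Fin 3, x = a.val + 1 := by
        simp only [Finset.mem_insert, Finset.mem_singleton] at hx
        exact ⟨⟨x - 1, by omega⟩, by simp; omega⟩
      refine Matrix.det_eq_zero_of_row_eq_zero a fun b => if_neg fun hh => hxI ?_
      rw [hh]
      simp
    · exact phiStar_eq_zero hinj

theorem lead_phiStar (hnd : L.Nodup) (hb : ∀ β ∈ L, 1 ≤ β.1 ∧ β.1 < β.2 ∧ β.2 ≤ N)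
    (hI : ∀ a, I a ∈ Finset.Icc 1 N) :
    Lead L (phiStar N L I) (tropVal L (Finset.univ.image I)) (∑ a, I a) := by
  induction L generalizing I with
  | nil => exact lead_nil I
  | cons β L ih =>
    obtain ⟨i, r⟩ := β
    obtain ⟨hβ, hnd⟩ := List.nodup_cons.1 hnd
    obtain ⟨h1, h2, h3⟩ := hb _ List.mem_cons_self
    have hi : i ∈ Finset.Icc 1 N := by simp at h1 h2 h3 ⊢; omega
    replace ih : ∀ {I : Fin 3 → ℕ}, (∀ a, I a ∈ Finset.Icc 1 N) →
        Lead L (phiStar N L I) (tropVal L (Finset.univ.image I)) (∑ a, I a) :=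
      fun hI => ih hnd (fun β hβ => hb β (List.mem_cons_of_mem _ hβ)) hI
    by_cases hinj : Function.Injective I
    · by_cases hr : ∃ z, I z = r
      · obtain ⟨z, hz⟩ := hr
        rw [phiStar_cons hi hI hinj z hz, tropVal]
        have hrI : r ∈ Finset.univ.image I := by simp [← hz]
        by_cases hiI : i ∈ Finset.univ.image I
        · obtain ⟨y, -, hy⟩ := Finset.mem_image.1 hiI
          have hyz : y ≠ z := fun hh => by subst hh; simp at h2; omega
          rw [extend_of_mem hiI, phiStar_eq_zero (I := Function.update I z i), mul_zero, add_zero]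
          · exact (ih hI).cons hβ
          · exact fun hh => hyz (hh (by simp [hyz, hy]))
        · have hu : Function.update I z i = swap i r ∘ I := by
            funext b
            have hbi : I b ≠ i := fun hh => hiI (hh ▸ by simp)
            by_cases hbz : b = z
            · subst hbz; simp [hz]
            · have hbr : I b ≠ r := fun hh => hbz (hinj (hh.trans hz.symm))
              simp [hbz, Equiv.swap_apply_of_ne_of_ne hbi hbr]
          have hI' : ∀ a, Function.update I z i a ∈ Finset.Icc 1 N := fun a => by
            by_cases ha : a = z
            · subst ha; simpa using hi
            · simpa [ha] using hI a
          have hl := ih hI'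
          rw [extend_eq_pick hrI hiI, Finset.image_image, ← hu]
          refine (ih hI).add_X_mul hl hβ ?_
          simp only [Ht, Fin.sum_univ_three] at h2 ⊢
          fin_cases z <;> simp at hz ⊢ <;> omega
      · push Not at hr
        rw [phiStar_cons_of_notMem hi hI hr, tropVal, extend_of_notMem (by simpa using hr)]
        exact (ih hI).cons hβ
    · refine Or.inl ⟨tropVal_bot _ fun hc => hinj ?_, phiStar_eq_zero hinj⟩
      rw [← Set.injOn_univ, ← Finset.coe_univ]
      exact Finset.injOn_of_card_image_eq (by rw [hc]; rfl)

theorem Lead.minSupp_eq {g : Expo} (h : Lead L f w s) (hw : w = g) :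
    minSupp L f = g ∧ Psi g + 6 = s := by
  obtain ⟨g', hg', hgs, hm⟩ := h.resolve_left fun hh => by simp [hw] at hh
  obtain rfl := WithBot.coe_injective (hg'.symm.trans hw)
  have hex : ∃ m ∈ f.support, ∀ m' ∈ f.support, psiLE L m m' := by
    refine ⟨g', hgs, fun m hms => Or.inr ⟨?_, ?_⟩⟩
    · have h1 := (hm m hms).2.1
      have h2 := (hm g' hgs).2.1
      omega
    · rcases (hm m hms).1 with rfl | hl
      · exact lexLE_refl
      · exact Or.inl hl
  refine ⟨?_, (hm g' hgs).2.1⟩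
  rw [minSupp, dif_pos hex]
  obtain ⟨hc1, hc2⟩ := hex.choose_spec
  rcases (hm _ hc1).1 with hl | hl
  · exact hl
  · exfalso
    have h1 := (hm _ hc1).2.1
    have h2 := (hm g' hgs).2.1
    rcases hc2 g' hgs with hc | ⟨-, hc⟩
    · omega
    · exact hl.not_lexLE hc

end LeadingTerm

section Triples

variable {n : ℕ} {I : Fin 2 → ℕ} {J : Fin 4 → ℕ}

theorem Sorted.image_subset {k : ℕ} {K : Fin k → ℕ} (hK : Sorted k n K) :
    Finset.univ.image K ⊆ Finset.Icc 1 n := by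
  intro x hx
  obtain ⟨a, -, rfl⟩ := Finset.mem_image.1 hx
  exact Finset.mem_Icc.2 (hK.2 a)

theorem Sorted.card_image {k : ℕ} {K : Fin k → ℕ} (hK : Sorted k n K) :
    (Finset.univ.image K).card = k := by
  rw [Finset.card_image_of_injective _ hK.1.injective, Finset.card_univ, Fintype.card_fin]

theorem Sorted.eq_of_image_eq {k : ℕ} {K K' : Fin k → ℕ} (hK : Sorted k n K)
    (hK' : Sorted k n K') (h : Finset.univ.image K = Finset.univ.image K') : K = K' := by
  refine (hK.1.range_inj hK'.1).1 ?_
  simpa using congrArg (fun F : Finset ℕ => (F : Set ℕ)) h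

theorem sorted_insert3 (hI : Sorted 2 n I) {j : ℕ} (h1 : 1 ≤ j) (hn : j ≤ n)
    (hj : ∀ t, I t ≠ j) :
    Sorted 3 n (insert3 I j) ∧
      Finset.univ.image (insert3 I j) = insert j (Finset.univ.image I) ∧
      ∑ a, insert3 I j a = j + ∑ a, I a := by
  have h01 : I 0 < I 1 := hI.1 (by decide)
  have b0 := hI.2 0
  have b1 := hI.2 1
  have n0 := hj 0
  have n1 := hj 1
  have key : insert3 I j = ![j, I 0, I 1] ∨ insert3 I j = ![I 0, j, I 1] ∨
      insert3 I j = ![I 0, I 1, j] := by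
    rcases lt_or_ge j (I 0) with h | h
    · left
      funext a
      fin_cases a <;> simp [insert3, h.not_ge, (h.trans h01).not_ge, h01.le]
    · rcases lt_or_ge j (I 1) with h' | h'
      · right; left
        funext a
        fin_cases a <;> simp [insert3, h, h'.not_ge]
      · right; right
        funext a
        fin_cases a <;> simp [insert3, h', h01.le]
  have himg : Finset.univ.image (insert3 I j) = insert j (Finset.univ.image I) := by
    ext x
    rcases key with h | h | h <;>
      simp [h, Fin.exists_fin_succ, eq_comm (a := x)] <;> tauto
  have hsum : ∑ a, insert3 I j a = j + ∑ a, I a := by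
    rcases key with h | h | h <;> simp [h, Fin.sum_univ_succ] <;> omega
  have hsort : List.Pairwise (· ≤ ·) (List.insertionSort (· ≤ ·) [I 0, I 1, j]) :=
    List.pairwise_insertionSort _ _
  refine ⟨⟨?_, ?_⟩, himg, hsum⟩
  · have hmono : Monotone (insert3 I j) := by
      refine Fin.monotone_iff_le_succ.2 fun a => ?_
      have hl : (List.insertionSort (· ≤ ·) [I 0, I 1, j]).length = 3 :=
        List.length_insertionSort _ _
      rw [List.pairwise_iff_getElem] at hsort
      have := hsort a.val (a.val + 1) (by omega) (by omega) (by omega)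
      simp only [insert3, Fin.val_castSucc, Fin.val_succ]
      rwa [List.getD_eq_getElem _ _ (by omega), List.getD_eq_getElem _ _ (by omega)]
    refine hmono.strictMono_of_injective ?_
    rw [← Set.injOn_univ, ← Finset.coe_univ]
    refine Finset.injOn_of_card_image_eq ?_
    rw [himg, Finset.card_insert_of_notMem (by simpa using hj), hI.card_image]
    rfl
  · intro a
    have : insert3 I j a ∈ insert j (Finset.univ.image I) := himg ▸ by simp
    rcases Finset.mem_insert.1 this with h | h
    · omega
    · exact Finset.mem_Icc.1 (hI.image_subset h)

theorem not_sorted_insert3 (hI : Sorted 2 n I) (t : Fin 2) : ¬ Sorted 3 n (insert3 I (I t)) := by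
  have h01 : I 0 < I 1 := hI.1 (by decide)
  intro h
  have h1 := h.1 (show (0 : Fin 3) < 1 by decide)
  have h2 := h.1 (show (1 : Fin 3) < 2 by decide)
  fin_cases t <;> simp [insert3, h01.not_ge, h01.le] at h1 h2

theorem sorted_erase4 (hJ : Sorted 4 n J) (x : Fin 4) :
    Sorted 3 n (erase4 J (J x)) ∧
      Finset.univ.image (erase4 J (J x)) = (Finset.univ.image J).erase (J x) ∧
      J x + ∑ a, erase4 J (J x) a = ∑ a, J a := by
  have key : erase4 J (J x) = J ∘ x.succAbove := by
    have hne : ∀ a b : Fin 4, J a = J b ↔ a = b := fun a b => hJ.1.injective.eq_iff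
    funext a
    fin_cases x <;> fin_cases a <;> simp [erase4, hne] <;> rfl
  rw [key]
  refine ⟨⟨hJ.1.comp (Fin.strictMono_succAbove x), fun a => hJ.2 _⟩, ?_, ?_⟩
  · rw [← Finset.image_image, Fin.image_succAbove_univ]
    ext y
    simp only [Finset.mem_image, Finset.mem_compl, Finset.mem_singleton, Finset.mem_erase,
      Finset.mem_univ, true_and]
    constructor
    · rintro ⟨a, ha, rfl⟩
      exact ⟨hJ.1.injective.ne ha, a, rfl⟩
    · rintro ⟨h, a, rfl⟩
      exact ⟨a, fun hh => h (by rw [hh]), rfl⟩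
  · rw [Fin.sum_univ_succAbove J x]
    rfl

theorem valS_spec {S : List (ℕ × ℕ)} (hS : IsIter n S) {K : Fin 3 → ℕ} (hK : Sorted 3 n K) :
    tropVal S (Finset.univ.image K) = valS n S K ∧ Psi (valS n S K) + 6 = ∑ a, K a := by
  obtain ⟨-, hnd, hb⟩ := hS.nodup_and_bounds
  have hf := hS.tropInv.finite _ hK.card_image (hK.image_subset.trans fun x hx => by
    simp at hx ⊢; omega)
  obtain ⟨g, hg⟩ := WithBot.ne_bot_iff_exists.1 hf
  have := (lead_phiStar hnd hb fun a => Finset.mem_Icc.2 (hK.2 a)).minSupp_eq hg.symm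
  rw [valS, this.1]
  exact ⟨hg.symm, this.2⟩

end Triples

section Binomial

variable {n : ℕ} {I : Fin 2 → ℕ} {J : Fin 4 → ℕ} {S : List (ℕ × ℕ)}

theorem wvec_spec (hS : IsIter n S) (hI : Sorted 2 n I) (hJ : Sorted 4 n J) {x : Fin 4}
    (hx : ∀ t, I t ≠ J x) :
    term (tropVal S) (Finset.univ.image I) (Finset.univ.image J) (J x) = wvec n S I J x ∧
      Psi (wvec n S I J x) + 12 = ∑ a, I a + ∑ a, J a := by
  obtain ⟨i1, i2, i3⟩ := sorted_insert3 hI (hJ.2 x).1 (hJ.2 x).2 hx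
  obtain ⟨j1, j2, j3⟩ := sorted_erase4 hJ x
  obtain ⟨v1, p1⟩ := valS_spec hS i1
  obtain ⟨v2, p2⟩ := valS_spec hS j1
  refine ⟨by rw [term, ← i2, ← j2, v1, v2, wvec, WithBot.coe_add], ?_⟩
  rw [wvec, Psi_add]
  omega

/-- Exactly two indices attain the minimum. -/
theorem exists_two_minima (hS : IsIter n S) (hI : Sorted 2 n I) (hJ : Sorted 4 n J) :
    ∃ a b : Fin 4, a ≠ b ∧ (∀ t : Fin 2, I t ≠ J a) ∧ (∀ t : Fin 2, I t ≠ J b) ∧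
      ∀ x : Fin 4, (∀ t : Fin 2, I t ≠ J x) →
        ((∀ y : Fin 4, (∀ t : Fin 2, I t ≠ J y) →
            psiLE S (wvec n S I J x) (wvec n S I J y)) ↔ (x = a ∨ x = b)) := by
  have hsub : Finset.Icc 1 n ⊆ Finset.Icc 1 (n + 1) := Finset.Icc_subset_Icc_right (by omega)
  have hpsi : ∀ x y : Fin 4, (∀ t, I t ≠ J x) → (∀ t, I t ≠ J y) →
      Psi (wvec n S I J x) = Psi (wvec n S I J y) := fun x y hx hy => by
    have h1 := (wvec_spec hS hI hJ hx).2
    have h2 := (wvec_spec hS hI hJ hy).2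
    omega
  rcases hS.tropInv.tie _ _ (hI.image_subset.trans hsub) (hJ.image_subset.trans hsub)
    hI.card_image hJ.card_image with h | ⟨x, hx, y, hy, hxy, g, hgx, hgy, h⟩
  · obtain ⟨x, hxJ, hxI⟩ := Finset.exists_mem_notMem_of_card_lt_card
      (show (Finset.univ.image I).card < (Finset.univ.image J).card by
        rw [hI.card_image, hJ.card_image]; norm_num)
    obtain ⟨a, -, rfl⟩ := Finset.mem_image.1 hxJ
    have := h _ hxJ
    rw [(wvec_spec hS hI hJ (x := a) (by simpa using hxI)).1] at this
    exact absurd this WithBot.coe_ne_bot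
  · obtain ⟨a, -, rfl⟩ := Finset.mem_image.1 hx
    obtain ⟨b, -, rfl⟩ := Finset.mem_image.1 hy
    have hfin : ∀ c, term (tropVal S) (Finset.univ.image I) (Finset.univ.image J) (J c) = g →
        (∀ t, I t ≠ J c) ∧ wvec n S I J c = g := by
      intro c hc
      have hI' : ∀ t, I t ≠ J c := by
        intro t ht
        rw [term, hS.tropInv.bot (K := insert (J c) _), WithBot.bot_add] at hc
        · exact WithBot.bot_ne_coe hc
        · rw [Finset.insert_eq_of_mem (Finset.mem_image.2 ⟨t, by simp, ht⟩), hI.card_image]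
          norm_num
      exact ⟨hI', WithBot.coe_injective ((wvec_spec hS hI hJ hI').1.symm.trans hc)⟩
    obtain ⟨ha, hwa⟩ := hfin a hgx
    obtain ⟨hb, hwb⟩ := hfin b hgy
    have hlt : ∀ y, (∀ t, I t ≠ J y) → y ≠ a → y ≠ b → lexLT S (wvec n S I J y) g :=
      fun y hy hya hyb => h (J y) (by simp) (hJ.1.injective.ne hya) (hJ.1.injective.ne hyb) _
        (wvec_spec hS hI hJ hy).1
    refine ⟨a, b, fun hh => hxy (by rw [hh]), ha, hb, fun x hx => ⟨fun hmin => ?_, fun hxab y hy => ?_⟩⟩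
    · by_contra! hne
      rcases hmin a ha with hc | ⟨-, hc⟩
      · exact hc.ne (hpsi x a hx ha)
      · rw [hwa] at hc
        exact (hlt x hx hne.1 hne.2).not_lexLE hc
    · have hwx : wvec n S I J x = g := by rcases hxab with rfl | rfl <;> assumption
      refine Or.inr ⟨hpsi x y hx hy, ?_⟩
      rw [hwx]
      by_cases hya : y = a
      · rw [hya, hwa]; exact lexLE_refl
      by_cases hyb : y = b
      · rw [hyb, hwb]; exact lexLE_refl
      exact Or.inl (hlt y hy hya hyb)

open scoped Classical in
/-- The exponent of the Plücker variable `p_K`. -/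
noncomputable def pexp (n : ℕ) (K : Fin 3 → ℕ) : MI n →₀ ℕ :=
  if h : Sorted 3 n K then Finsupp.single ⟨K, h⟩ 1 else 0

theorem pexp_of_sorted {K : Fin 3 → ℕ} (h : Sorted 3 n K) :
    pexp n K = Finsupp.single ⟨K, h⟩ 1 := dif_pos h

theorem pvar_of_sorted {K : Fin 3 → ℕ} (h : Sorted 3 n K) :
    pvar n K = monomial (pexp n K) 1 := by
  rw [pvar, dif_pos h, pexp_of_sorted h]; rfl

/-- The exponent of the term of `R_{I,J}` with index `x`. -/
noncomputable def rexp (n : ℕ) (I : Fin 2 → ℕ) (J : Fin 4 → ℕ) (x : Fin 4) : MI n →₀ ℕ :=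
  pexp n (insert3 I (J x)) + pexp n (erase4 J (J x))

theorem MSdot_rexp (hI : Sorted 2 n I) (hJ : Sorted 4 n J) {x : Fin 4} (hx : ∀ t, I t ≠ J x) :
    MSdot n S (rexp n I J x) = wvec n S I J x := by
  rw [MSdot, rexp, pexp_of_sorted (sorted_insert3 hI (hJ.2 x).1 (hJ.2 x).2 hx).1,
    pexp_of_sorted (sorted_erase4 hJ x).1, Finsupp.sum_add_index' (by simp)
    (by intros; rw [add_smul]), Finsupp.sum_single_index (by simp),
    Finsupp.sum_single_index (by simp), one_smul, one_smul, wvec]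

theorem exists_complementary_pair : ∀ s t : Fin 4, s < t → ∃ p q : Fin 4, p ≠ q ∧ p ≠ s ∧ p ≠ t ∧
    q ≠ s ∧ q ≠ t ∧ (∀ c, c = p ∨ c = q ∨ c = s ∨ c = t) ∧
    Odd (((Finset.univ.filter fun b : Fin 2 => ![s, t] b < p).card +
        (Finset.univ.filter fun b : Fin 4 => p < b).card) +
      ((Finset.univ.filter fun b : Fin 2 => ![s, t] b < q).card +
        (Finset.univ.filter fun b : Fin 4 => q < b).card)) := by
  decide

theorem Rrel_eq_zero (hI : Sorted 2 n I) (hJ : Sorted 4 n J)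
    (hIJ : Finset.univ.image I ⊆ Finset.univ.image J) : Rrel n I J = 0 := by
  have hex : ∀ a, ∃ s, J s = I a := fun a => by
    simpa using hIJ (Finset.mem_image_of_mem I (Finset.mem_univ a))
  obtain ⟨s, hs⟩ := hex 0
  obtain ⟨t, ht⟩ := hex 1
  have hI' : I = fun b => J (![s, t] b) := by
    funext b
    fin_cases b <;> simp [hs, ht]
  have hst : s < t := by
    rw [← hJ.1.lt_iff_lt, hs, ht]
    exact hI.1 (by decide)
  obtain ⟨p, q, hpq, hps, hpt, hqs, hqt, hc, hodd⟩ := exists_complementary_pair s t hst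
  have hnot : ∀ x, x ≠ s → x ≠ t → ∀ b, I b ≠ J x := by
    intro x h1 h2 b hb
    fin_cases b
    · exact h1 (hJ.1.injective (hb.symm.trans hs.symm))
    · exact h2 (hJ.1.injective (hb.symm.trans ht.symm))
  have hswap : ∀ p q : Fin 4, p ≠ q → p ≠ s → p ≠ t → q ≠ s → q ≠ t →
      (∀ c, c = p ∨ c = q ∨ c = s ∨ c = t) → insert3 I (J p) = erase4 J (J q) := by
    intro p q hpq hps hpt hqs hqt hc
    obtain ⟨h1, h2, -⟩ := sorted_insert3 hI (hJ.2 p).1 (hJ.2 p).2 (hnot p hps hpt)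
    obtain ⟨h3, h4, -⟩ := sorted_erase4 hJ q
    refine h1.eq_of_image_eq h3 ?_
    rw [h2, h4]
    refine Finset.eq_of_subset_of_card_le (Finset.insert_subset ?_ fun x hx => ?_) ?_
    · simp [hJ.1.injective.ne hpq]
    · refine Finset.mem_erase.2 ⟨?_, hIJ hx⟩
      rintro rfl
      obtain ⟨b, -, hb⟩ := Finset.mem_image.1 hx
      exact hnot q hqs hqt b hb
    · rw [Finset.card_insert_of_notMem (by simpa using hnot p hps hpt), hI.card_image,
        Finset.card_erase_of_mem (by simp), hJ.card_image]
  rw [Rrel, Finset.sum_eq_add p q hpq]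
  · rw [hswap p q hpq hps hpt hqs hqt hc, ← hswap q p hpq.symm hqs hqt hps hpt
      (fun c => by have := hc c; tauto), mul_comm (pvar n (erase4 J (J q))), ← add_mul]
    simp only [hI', hJ.1.lt_iff_lt]
    refine mul_eq_zero_of_left ?_ _
    rcases Nat.odd_add.1 hodd with h
    rcases Nat.even_or_odd ((Finset.univ.filter fun b : Fin 2 => ![s, t] b < q).card +
        (Finset.univ.filter fun b : Fin 4 => q < b).card) with he | ho
    · rw [he.neg_one_pow, (h.2 he).neg_one_pow, neg_add_cancel]
    · rw [ho.neg_one_pow, (Nat.not_odd_iff_even.1 fun hh =>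
        Nat.not_even_iff_odd.2 ho (h.1 hh)).neg_one_pow, add_neg_cancel]
  · rintro c - ⟨h1, h2⟩
    have : ∃ b, I b = J c := by
      rcases hc c with rfl | rfl | rfl | rfl
      · exact absurd rfl h1
      · exact absurd rfl h2
      · exact ⟨0, hs.symm⟩
      · exact ⟨1, ht.symm⟩
    obtain ⟨b, hb⟩ := this
    rw [← hb, pvar, dif_neg (not_sorted_insert3 hI b), zero_mul, mul_zero]
  · simp
  · simp

theorem rexp_injective (hI : Sorted 2 n I) (hJ : Sorted 4 n J)
    (hIJ : ¬ Finset.univ.image I ⊆ Finset.univ.image J) {x y : Fin 4} (hx : ∀ t, I t ≠ J x)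
    (hy : ∀ t, I t ≠ J y) (h : rexp n I J x = rexp n I J y) : x = y := by
  obtain ⟨x1, x2, -⟩ := sorted_insert3 hI (hJ.2 x).1 (hJ.2 x).2 hx
  obtain ⟨y1, y2, -⟩ := sorted_insert3 hI (hJ.2 y).1 (hJ.2 y).2 hy
  obtain ⟨x3, x4, -⟩ := sorted_erase4 hJ x
  obtain ⟨y3, y4, -⟩ := sorted_erase4 hJ y
  rw [rexp, rexp, pexp_of_sorted x1, pexp_of_sorted x3, pexp_of_sorted y1, pexp_of_sorted y3] at h
  have h' := DFunLike.congr_fun h ⟨_, x1⟩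
  by_cases e1 : insert3 I (J y) = insert3 I (J x)
  · have hm : J x ∈ insert (J y) (Finset.univ.image I) := by
      rw [← y2, e1, x2]
      exact Finset.mem_insert_self _ _
    rcases Finset.mem_insert.1 hm with hm | hm
    · exact hJ.1.injective hm
    · obtain ⟨t, -, ht⟩ := Finset.mem_image.1 hm
      exact absurd ht (hx t)
  · by_cases e2 : erase4 J (J y) = insert3 I (J x)
    · refine absurd (fun z hz => ?_) hIJ
      refine Finset.mem_of_mem_erase (a := J y) ?_
      rw [← y4, e2, x2]
      exact Finset.mem_insert_of_mem hz
    · simp [Finsupp.single_apply, Subtype.ext_iff, e1, e2] at h'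

theorem support_sum_monomial {σ ι : Type*} [DecidableEq (σ →₀ ℕ)] (X : Finset ι)
    (m : ι → σ →₀ ℕ) (c : ι → ℂ)
    (hc : ∀ x ∈ X, c x ≠ 0) (hm : Set.InjOn m X) :
    (∑ x ∈ X, monomial (m x) (c x)).support = X.image m := by
  classical
  ext d
  rw [mem_support_iff, coeff_sum, Finset.mem_image]
  simp only [coeff_monomial]
  constructor
  · intro h
    obtain ⟨x, hx, h⟩ := Finset.exists_ne_zero_of_sum_ne_zero h
    exact ⟨x, hx, by_contra fun hh => h (if_neg hh)⟩
  · rintro ⟨x, hx, rfl⟩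
    rw [Finset.sum_eq_single x ?_ fun h => absurd hx h, if_pos rfl]
    · exact hc x hx
    · exact fun y hy hyx => if_neg fun hh => hyx (hm hy hx hh)

open scoped Classical in
theorem support_inM (f : PRing n) : (inM n S f).support =
    f.support.filter fun m => ∀ m' ∈ f.support, psiLE S (MSdot n S m) (MSdot n S m') := by
  rw [inM, support_sum_monomial _ (fun m => m) (fun m => coeff m f)]
  · exact Finset.image_id'
  · exact fun m hm => mem_support_iff.1 (Finset.mem_filter.1 hm).1
  · exact Function.injective_id.injOn

open scoped Classical in
theorem support_Rrel (hI : Sorted 2 n I) (hJ : Sorted 4 n J)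
    (hIJ : ¬ Finset.univ.image I ⊆ Finset.univ.image J) :
    (Rrel n I J).support =
      (Finset.univ.filter fun x : Fin 4 => ∀ t, I t ≠ J x).image (rexp n I J) := by
  rw [← support_sum_monomial _ (rexp n I J) (fun a =>
    (-1) ^ ((Finset.univ.filter fun b : Fin 2 => I b < J a).card +
      (Finset.univ.filter fun b : Fin 4 => J a < J b).card)) (by simp)
    (fun x hx y hy => rexp_injective hI hJ hIJ (by simpa using hx) (by simpa using hy)), Rrel]
  congr 1
  rw [Finset.sum_filter]
  refine Finset.sum_congr rfl fun x _ => ?_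
  split_ifs with hx
  · rw [pvar_of_sorted (sorted_insert3 hI (hJ.2 x).1 (hJ.2 x).2 hx).1,
      pvar_of_sorted (sorted_erase4 hJ x).1, monomial_mul, mul_one, ← rexp,
      show (-1 : PRing n) = C (-1) by simp, ← C_pow, C_mul_monomial, mul_one]
  · push Not at hx
    obtain ⟨t, ht⟩ := hx
    rw [← ht, pvar, dif_neg (not_sorted_insert3 hI t), zero_mul, mul_zero]

end Binomial

/-- The initial form `In_{M_S}(R_{I,J})` of a nonzero Plücker relation is a binomial
(exactly two monomials in its support); equivalently exactly two indices `j ∈ J ∖ I`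
achieve the `⪯_{Ψ_S}`-minimum of `{ v_S(p̄_{I∪j}) + v_S(p̄_{J∖j}) : j ∈ J ∖ I }`. -/
theorem initial_form_binomial (n : ℕ) (hn : 4 ≤ n) (S : List (ℕ × ℕ)) (hS : IsIter n S)
    (I : Fin 2 → ℕ) (J : Fin 4 → ℕ) (hI : Sorted 2 n I) (hJ : Sorted 4 n J)
    (hR : Rrel n I J ≠ 0) :
    (inM n S (Rrel n I J)).support.card = 2 ∧
    ∃ a b : Fin 4, a ≠ b ∧ (∀ t : Fin 2, I t ≠ J a) ∧ (∀ t : Fin 2, I t ≠ J b) ∧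
      ∀ x : Fin 4, (∀ t : Fin 2, I t ≠ J x) →
        ((∀ y : Fin 4, (∀ t : Fin 2, I t ≠ J y) →
            psiLE S (wvec n S I J x) (wvec n S I J y)) ↔ (x = a ∨ x = b)) := by
  have hIJ : ¬ Finset.univ.image I ⊆ Finset.univ.image J := fun h => hR (Rrel_eq_zero hI hJ h)
  obtain ⟨a, b, hab, ha, hb, hmin⟩ := exists_two_minima hS hI hJ
  refine ⟨?_, a, b, hab, ha, hb, hmin⟩
  classical
  have hset : (inM n S (Rrel n I J)).support = {rexp n I J a, rexp n I J b} := by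
    rw [support_inM, support_Rrel hI hJ hIJ]
    ext m
    simp only [Finset.mem_filter, Finset.mem_image, Finset.mem_univ, true_and, Finset.mem_insert,
      Finset.mem_singleton]
    constructor
    · rintro ⟨⟨x, hx, rfl⟩, h⟩
      have := (hmin x hx).1 fun y hy => by
        have := h _ ⟨y, hy, rfl⟩
        rwa [MSdot_rexp hI hJ hx, MSdot_rexp hI hJ hy] at this
      exact this.imp (fun h => by rw [h]) fun h => by rw [h]
    · intro hm
      obtain ⟨x, hxab, hx, rfl⟩ : ∃ x, (x = a ∨ x = b) ∧ (∀ t, I t ≠ J x) ∧ m = rexp n I J x := by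
        rcases hm with rfl | rfl
        exacts [⟨a, Or.inl rfl, ha, rfl⟩, ⟨b, Or.inr rfl, hb, rfl⟩]
      refine ⟨⟨x, hx, rfl⟩, ?_⟩
      rintro _ ⟨y, hy, rfl⟩
      rw [MSdot_rexp hI hJ hx, MSdot_rexp hI hJ hy]
      exact (hmin x hx).2 hxab y hy
  rw [hset, Finset.card_pair fun h => hab (rexp_injective hI hJ hIJ ha hb h)]
end
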